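/- arXiv:quant-ph/0406063 — 4 statements merged into one kernel-verified Lean document; each statement's English description precedes it below -/
import Mathlib

section
/- Let Q ≤ C^N be a subspace of dimension K with projector P, and E a linear operator on C^N. The variance over uniformly random unit vectors ψ ∈ Q of ⟨ψ|E|ψ⟩ equals [K·tr(E†PEP) − tr(E†P)tr(EP)] / [K²(K+1)]. -/
open Matrix MeasureTheory

/-- A continuous function is integrable for a finite measure concentrated on unit vectors. -/
theorem integrable_of_ae_unit {N : ℕ} {μ : Measure (Fin N → ℂ)} [IsFiniteMeasure μ]
    (hunit : ∀ᵐ ψ ∂μ, star ψ ⬝ᵥ ψ = 1) {g : (Fin N → ℂ) → ℂ} (hg : Continuous g) :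
    Integrable g μ := by
  obtain ⟨C, hC⟩ := (isCompact_closedBall (0 : Fin N → ℂ) 1).exists_bound_of_continuousOn
    hg.continuousOn
  refine Integrable.of_bound hg.aestronglyMeasurable C ?_
  filter_upwards [hunit] with ψ hψ
  refine hC ψ ?_
  rw [mem_closedBall_zero_iff, pi_norm_le_iff_of_nonneg zero_le_one]
  intro i
  have hsum : ∑ j, ‖ψ j‖ ^ 2 = 1 := by
    have h : ((∑ j, ‖ψ j‖ ^ 2 : ℝ) : ℂ) = 1 := by
      rw [← hψ]
      simp [dotProduct, Complex.conj_mul']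
    exact_mod_cast h
  have hi : ‖ψ i‖ ^ 2 ≤ 1 :=
    hsum ▸ Finset.single_le_sum (f := fun j => ‖ψ j‖ ^ 2) (fun j _ => sq_nonneg _)
      (Finset.mem_univ i)
  exact (sq_le_one_iff₀ (norm_nonneg _)).1 hi

/-- Polarization: a form that is antilinear and symmetric in the first two arguments, linear and
symmetric in the last two, and vanishes on the diagonal is zero. -/
theorem eq_zero_of_diagonal_eq_zero {V : Type*} [AddCommGroup V] [Module ℂ V]
    {H : V → V → V → V → ℂ}
    (hadd_left : ∀ v v' w x y, H (v + v') w x y = H v w x y + H v' w x y)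
    (hsmul_left : ∀ (c : ℂ) v w x y, H (c • v) w x y = star c * H v w x y)
    (hsymm_left : ∀ v w x y, H v w x y = H w v x y)
    (hadd_right : ∀ v w x x' y, H v w (x + x') y = H v w x y + H v w x' y)
    (hsmul_right : ∀ (c : ℂ) v w x y, H v w (c • x) y = c * H v w x y)
    (hsymm_right : ∀ v w x y, H v w x y = H v w y x)
    (hdiag : ∀ v, H v v v v = 0) (v w x y : V) : H v w x y = 0 := by
  have hadd_left' : ∀ v w w' x y, H v (w + w') x y = H v w x y + H v w' x y := by
    intro v w w' x y
    rw [hsymm_left, hadd_left, hsymm_left w, hsymm_left w']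
  have hsmul_left' : ∀ (c : ℂ) v w x y, H v (c • w) x y = star c * H v w x y := by
    intro c v w x y
    rw [hsymm_left, hsmul_left, hsymm_left w]
  have hadd_right' : ∀ v w x y y', H v w x (y + y') = H v w x y + H v w x y' := by
    intro v w x y y'
    rw [hsymm_right, hadd_right, hsymm_right v w y, hsymm_right v w y']
  have hsmul_right' : ∀ (c : ℂ) v w x y, H v w x (c • y) = c * H v w x y := by
    intro c v w x y
    rw [hsymm_right, hsmul_right, hsymm_right v w y]
  have hsum : ∀ v w, H v v w w + H w w v v = 0 := by
    intro v w
    have h (c : ℂ) := hdiag (v + c • w)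
    simp only [hadd_left, hadd_left', hadd_right, hadd_right', hsmul_left, hsmul_left',
      hsmul_right, hsmul_right', hdiag] at h
    have h1 := h 1
    have h2 := h (-1)
    have h3 := h Complex.I
    have h4 := h (-Complex.I)
    simp only [star_one, star_neg, Complex.star_def, Complex.conj_I] at h1 h2 h3 h4
    have hI : Complex.I * Complex.I = -1 := Complex.I_mul_I
    linear_combination (h1 + h2 - h3 - h4) / 4 + (H v v w w + H w w v v - H v w v w -
      H v w w v - H w v v w - H w v w v) / 2 * hI
  have hpair : ∀ v w, H v v w w = 0 := by
    intro v w
    have h1 := hsum v w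
    have h2 := hsum v ((1 + Complex.I) • w)
    simp only [hsmul_left, hsmul_left', hsmul_right, hsmul_right', star_add, star_one,
      Complex.star_def, Complex.conj_I] at h2
    have hI : Complex.I * Complex.I = -1 := Complex.I_mul_I
    have h3 : 4 * Complex.I * H v v w w = 0 := by
      linear_combination h2 + 2 * Complex.I * h1 - (H v v w w + H w w v v) * hI
    simpa using h3
  have hleft : ∀ v w x, H v w x x = 0 := by
    intro v w x
    have h := hpair (v + w) x
    simp only [hadd_left, hadd_left', hpair] at h
    linear_combination h / 2 + hsymm_left v w x x / 2
  have h := hleft v w (x + y)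
  simp only [hadd_right, hadd_right', hleft] at h
  linear_combination h / 2 + hsymm_right v w x y / 2

/-- Two vectors of equal length are exchanged by a unitary that differs from the identity by a
multiple of the projector onto their difference. -/
theorem exists_unitary_mulVec_eq {N : ℕ} {v w : Fin N → ℂ}
    (hvw : star v ⬝ᵥ v = star w ⬝ᵥ w) :
    ∃ U ∈ Matrix.unitaryGroup (Fin N) ℂ, U.mulVec v = w ∧
      ∀ Q : Submodule ℂ (Fin N → ℂ), v ∈ Q → w ∈ Q → ∀ x ∈ Q, U.mulVec x ∈ Q := by
  set u := v - w with hu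
  set d := star u ⬝ᵥ v with hd
  have hds : d + star d = star u ⬝ᵥ u := by
    rw [hd, ← star_dotProduct_star, star_star]
    simp only [hu, star_sub, sub_dotProduct, dotProduct_sub]
    linear_combination hvw
  by_cases h0 : d = 0
  · have hu0 : u = 0 := by
      rw [h0, star_zero, add_zero] at hds
      open scoped ComplexOrder in
      exact dotProduct_star_self_eq_zero.1 hds.symm
    refine ⟨1, one_mem _, ?_, fun Q _ _ x hx => by simpa using hx⟩
    rw [one_mulVec]
    exact sub_eq_zero.1 hu0
  have hU (x : Fin N → ℂ) : (1 - d⁻¹ • vecMulVec u (star u)).mulVec x =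
      x - (d⁻¹ * (star u ⬝ᵥ x)) • u := by
    rw [sub_mulVec, one_mulVec, smul_mulVec, vecMulVec_mulVec]
    ext i
    simp
    ring
  refine ⟨1 - d⁻¹ • vecMulVec u (star u), ?_, ?_, ?_⟩
  · have hM : vecMulVec u (star u) * vecMulVec u (star u) =
        (d + star d) • vecMulVec u (star u) := by
      rw [vecMulVec_mul_vecMulVec, ← hds, vecMulVec_smul]
    have hcoef : d⁻¹ * (star d)⁻¹ * (d + star d) = d⁻¹ + (star d)⁻¹ := by
      have hstar : star d ≠ 0 := star_ne_zero.2 h0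
      field_simp
      ring
    rw [mem_unitaryGroup_iff, star_eq_conjTranspose, conjTranspose_sub, conjTranspose_one,
      conjTranspose_smul, conjTranspose_vecMulVec, star_star, star_inv₀, mul_sub, mul_one,
      sub_mul, one_mul, smul_mul_smul_comm, hM, smul_smul, hcoef]
    module
  · rw [hU, ← hd, inv_mul_cancel₀ h0, one_smul, hu, sub_sub_cancel]
  · intro Q hv hw x hx
    rw [hU]
    exact Q.sub_mem hx (Q.smul_mem _ (Q.sub_mem hv hw))

/-- The fourth moment `∫ ⟨v,ψ⟩⟨w,ψ⟩⟨ψ,x⟩⟨ψ,y⟩`. -/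
noncomputable def fourthMoment {N : ℕ} (μ : Measure (Fin N → ℂ)) (v w x y : Fin N → ℂ) : ℂ :=
  ∫ ψ, (star v ⬝ᵥ ψ) * (star w ⬝ᵥ ψ) * (star ψ ⬝ᵥ x) * (star ψ ⬝ᵥ y) ∂μ

theorem continuous_fourthMoment_integrand {N : ℕ} (v w x y : Fin N → ℂ) :
    Continuous fun ψ : Fin N → ℂ =>
      (star v ⬝ᵥ ψ) * (star w ⬝ᵥ ψ) * (star ψ ⬝ᵥ x) * (star ψ ⬝ᵥ y) := by
  simp only [dotProduct, Pi.star_apply]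
  fun_prop

theorem fourthMoment_mulVec {N : ℕ} {μ : Measure (Fin N → ℂ)} {U : Matrix (Fin N) (Fin N) ℂ}
    (hU : U ∈ Matrix.unitaryGroup (Fin N) ℂ) (hmap : μ.map U.mulVec = μ)
    (v w x y : Fin N → ℂ) :
    fourthMoment μ (U.mulVec v) (U.mulVec w) (U.mulVec x) (U.mulVec y) =
      fourthMoment μ v w x y := by
  have hip (a b : Fin N → ℂ) : star (U.mulVec a) ⬝ᵥ U.mulVec b = star a ⬝ᵥ b := by
    rw [star_mulVec, ← dotProduct_mulVec, mulVec_mulVec, ← star_eq_conjTranspose,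
      mem_unitaryGroup_iff'.1 hU, one_mulVec]
  have hcont : Continuous U.mulVec := by fun_prop
  conv_lhs => rw [fourthMoment, ← hmap]
  rw [integral_map hcont.aemeasurable
    (continuous_fourthMoment_integrand _ _ _ _).aestronglyMeasurable]
  simp only [hip]
  rfl

theorem fourthMoment_smul {N : ℕ} (μ : Measure (Fin N → ℂ)) (r : ℝ) (v : Fin N → ℂ) :
    fourthMoment μ ((r : ℂ) • v) ((r : ℂ) • v) ((r : ℂ) • v) ((r : ℂ) • v) =
      (r : ℂ) ^ 4 * fourthMoment μ v v v v := by
  rw [fourthMoment, fourthMoment, ← integral_const_mul]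
  congr 1 with ψ
  simp
  ring

/-- On a subspace on which the measure is unitarily invariant, the diagonal fourth moment is a
multiple of the fourth power of the norm. -/
theorem exists_fourthMoment_diag {N : ℕ} {μ : Measure (Fin N → ℂ)} {Q : Submodule ℂ (Fin N → ℂ)}
    {v₀ : Fin N → ℂ} (hv₀ : v₀ ∈ Q) (hunit : star v₀ ⬝ᵥ v₀ = 1)
    (hinv : ∀ U : Matrix (Fin N) (Fin N) ℂ, U ∈ Matrix.unitaryGroup (Fin N) ℂ →
      (∀ v ∈ Q, U.mulVec v ∈ Q) → μ.map U.mulVec = μ) :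
    ∃ a : ℂ, ∀ v ∈ Q, fourthMoment μ v v v v = a * (star v ⬝ᵥ v) ^ 2 := by
  refine ⟨fourthMoment μ v₀ v₀ v₀ v₀, fun v hv => ?_⟩
  set r := √(∑ i, ‖v i‖ ^ 2) with hr
  have hrv : star v ⬝ᵥ v = (r : ℂ) ^ 2 := by
    rw [← Complex.ofReal_pow, hr, Real.sq_sqrt (Finset.sum_nonneg fun i _ => sq_nonneg _)]
    simp [dotProduct, Complex.conj_mul']
  obtain ⟨U, hU, hUv, hUQ⟩ := exists_unitary_mulVec_eq (v := (r : ℂ) • v₀) (w := v) (by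
    rw [hrv]
    simp [hunit]
    ring)
  have hr₀ : (r : ℂ) • v₀ ∈ Q := Q.smul_mem _ hv₀
  have h := fourthMoment_mulVec hU (hinv U hU (hUQ Q hr₀ hv))
    ((r : ℂ) • v₀) ((r : ℂ) • v₀) ((r : ℂ) • v₀) ((r : ℂ) • v₀)
  rw [hUv, fourthMoment_smul] at h
  rw [h, hrv]
  ring

/-- The fourth moments are a multiple of the symmetrization of `P ⊗ P`. -/
theorem exists_fourthMoment_eq {N : ℕ} {Q : Submodule ℂ (Fin N → ℂ)}
    {P : Matrix (Fin N) (Fin N) ℂ} (hPherm : P.IsHermitian) (hPidem : P * P = P)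
    (hPrange : ∀ v : Fin N → ℂ, v ∈ Q ↔ P.mulVec v = v)
    {μ : Measure (Fin N → ℂ)} [IsProbabilityMeasure μ]
    (hsupp : ∀ᵐ ψ ∂μ, ψ ∈ Q ∧ star ψ ⬝ᵥ ψ = 1)
    (hinv : ∀ U : Matrix (Fin N) (Fin N) ℂ, U ∈ Matrix.unitaryGroup (Fin N) ℂ →
      (∀ v ∈ Q, U.mulVec v ∈ Q) → μ.map U.mulVec = μ) :
    ∃ a : ℂ, ∀ v w x y, fourthMoment μ v w x y =
      a * ((star v ⬝ᵥ P.mulVec x) * (star w ⬝ᵥ P.mulVec y) +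
        (star v ⬝ᵥ P.mulVec y) * (star w ⬝ᵥ P.mulVec x)) := by
  obtain ⟨v₀, hv₀, hunit⟩ := hsupp.exists
  obtain ⟨a, ha⟩ := exists_fourthMoment_diag hv₀ hunit hinv
  have hint (v w x y : Fin N → ℂ) := integrable_of_ae_unit (hsupp.mono fun _ h => h.2)
    (continuous_fourthMoment_integrand v w x y)
  have hproj (v : Fin N → ℂ) : fourthMoment μ (P.mulVec v) (P.mulVec v) (P.mulVec v) (P.mulVec v) =
      fourthMoment μ v v v v := by
    refine integral_congr_ae ?_
    filter_upwards [hsupp] with ψ hψ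
    have hψP := (hPrange ψ).1 hψ.1
    have h1 : star (P.mulVec v) ⬝ᵥ ψ = star v ⬝ᵥ ψ := by
      rw [star_mulVec, ← dotProduct_mulVec, hPherm.eq, hψP]
    have h2 : star ψ ⬝ᵥ P.mulVec v = star ψ ⬝ᵥ v := by
      conv_rhs => rw [← hψP, star_mulVec, ← dotProduct_mulVec, hPherm.eq]
    simp only [h1, h2]
  refine ⟨a / 2, fun v w x y => sub_eq_zero.1 ?_⟩
  refine eq_zero_of_diagonal_eq_zero (H := fun v w x y => fourthMoment μ v w x y -
    a / 2 * ((star v ⬝ᵥ P.mulVec x) * (star w ⬝ᵥ P.mulVec y) +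
        (star v ⬝ᵥ P.mulVec y) * (star w ⬝ᵥ P.mulVec x))) ?_ ?_ ?_ ?_ ?_ ?_ ?_ v w x y
  · intro v v' w x y
    have h : fourthMoment μ (v + v') w x y = fourthMoment μ v w x y + fourthMoment μ v' w x y := by
      rw [fourthMoment, fourthMoment, fourthMoment, ← integral_add (hint _ _ _ _) (hint _ _ _ _)]
      simp only [star_add, add_dotProduct, add_mul]
    simp only [h, star_add, add_dotProduct]
    ring
  · intro c v w x y
    have h : fourthMoment μ (c • v) w x y = star c * fourthMoment μ v w x y := by
      rw [fourthMoment, fourthMoment, ← integral_const_mul]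
      simp only [star_smul, smul_dotProduct, smul_eq_mul, mul_assoc]
    simp only [h, star_smul, smul_dotProduct, smul_eq_mul]
    ring
  · intro v w x y
    have h : fourthMoment μ v w x y = fourthMoment μ w v x y := by
      simp only [fourthMoment, mul_comm (star v ⬝ᵥ _)]
    simp only [h]
    ring
  · intro v w x x' y
    have h : fourthMoment μ v w (x + x') y = fourthMoment μ v w x y + fourthMoment μ v w x' y := by
      rw [fourthMoment, fourthMoment, fourthMoment, ← integral_add (hint _ _ _ _) (hint _ _ _ _)]
      simp only [dotProduct_add, add_mul, mul_add]
    simp only [h, mulVec_add, dotProduct_add]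
    ring
  · intro c v w x y
    have h : fourthMoment μ v w (c • x) y = c * fourthMoment μ v w x y := by
      rw [fourthMoment, fourthMoment, ← integral_const_mul]
      congr 1 with ψ
      simp only [dotProduct_smul, smul_eq_mul]
      ring
    simp only [h, mulVec_smul, dotProduct_smul, smul_eq_mul]
    ring
  · intro v w x y
    have h : fourthMoment μ v w x y = fourthMoment μ v w y x := by
      rw [fourthMoment, fourthMoment]
      congr 1 with ψ
      ring
    simp only [h]
    ring
  · intro v
    have hPv : P.mulVec v ∈ Q := (hPrange _).2 (by rw [mulVec_mulVec, hPidem])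
    have h := ha _ hPv
    rw [hproj, star_mulVec, ← dotProduct_mulVec, hPherm.eq, mulVec_mulVec, hPidem] at h
    simp only [h]
    ring

theorem continuous_quadraticForm {N : ℕ} (A : Matrix (Fin N) (Fin N) ℂ) :
    Continuous fun ψ : Fin N → ℂ => star ψ ⬝ᵥ A.mulVec ψ := by
  fun_prop

/-- The mixed second moment of two quadratic forms, from the fourth moments. -/
theorem integral_quadraticForm_mul {N : ℕ} {μ : Measure (Fin N → ℂ)} [IsFiniteMeasure μ]
    (hunit : ∀ᵐ ψ ∂μ, star ψ ⬝ᵥ ψ = 1) {P : Matrix (Fin N) (Fin N) ℂ} {a : ℂ}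
    (ha : ∀ v w x y, fourthMoment μ v w x y =
      a * ((star v ⬝ᵥ P.mulVec x) * (star w ⬝ᵥ P.mulVec y) +
        (star v ⬝ᵥ P.mulVec y) * (star w ⬝ᵥ P.mulVec x)))
    (A B : Matrix (Fin N) (Fin N) ℂ) :
    ∫ ψ, (star ψ ⬝ᵥ A.mulVec ψ) * (star ψ ⬝ᵥ B.mulVec ψ) ∂μ =
      a * ((A * P).trace * (B * P).trace + (A * P * B * P).trace) := by
  have hstar (i : Fin N) : star (Pi.single i (1 : ℂ) : Fin N → ℂ) = Pi.single i 1 := by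
    rw [← Pi.single_star, star_one]
  have hT (i j k l : Fin N) : ∫ ψ : Fin N → ℂ, ψ i * ψ j * star (ψ k) * star (ψ l) ∂μ =
      a * (P i k * P j l + P i l * P j k) := by
    have h := ha (Pi.single i 1) (Pi.single j 1) (Pi.single k 1) (Pi.single l 1)
    simpa [fourthMoment, hstar] using h
  have hexp (ψ : Fin N → ℂ) : (star ψ ⬝ᵥ A.mulVec ψ) * (star ψ ⬝ᵥ B.mulVec ψ) =
      ∑ k, ∑ i, ∑ l, ∑ j, A k i * B l j * (ψ i * ψ j * star (ψ k) * star (ψ l)) := by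
    have hq (A : Matrix (Fin N) (Fin N) ℂ) :
        star ψ ⬝ᵥ A.mulVec ψ = ∑ k, ∑ i, A k i * (star (ψ k) * ψ i) := by
      simp only [dotProduct, mulVec, Finset.mul_sum, Pi.star_apply, mul_left_comm]
    rw [hq A, hq B]
    simp only [Finset.sum_mul]
    simp only [Finset.mul_sum]
    refine Finset.sum_congr rfl fun k _ => Finset.sum_congr rfl fun i _ =>
      Finset.sum_congr rfl fun l _ => Finset.sum_congr rfl fun j _ => ?_
    ring
  simp only [hexp]
  have hint (c : ℂ) (i j k l : Fin N) :
      Integrable (fun ψ : Fin N → ℂ => c * (ψ i * ψ j * star (ψ k) * star (ψ l))) μ :=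
    integrable_of_ae_unit hunit (by fun_prop)
  rw [integral_finsetSum _ fun k _ => integrable_finsetSum _ fun i _ =>
    integrable_finsetSum _ fun l _ => integrable_finsetSum _ fun j _ => hint _ _ _ _ _]
  simp_rw [integral_finsetSum _ fun i _ => integrable_finsetSum _ fun l _ =>
    integrable_finsetSum _ fun j _ => hint _ _ _ _ _, integral_finsetSum _ fun l _ =>
    integrable_finsetSum _ fun j _ => hint _ _ _ _ _, integral_finsetSum _ fun j _ =>
    hint _ _ _ _ _, integral_const_mul, hT]
  have htrace (A : Matrix (Fin N) (Fin N) ℂ) : (A * P).trace = ∑ k, ∑ i, A k i * P i k := by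
    simp only [trace, diag_apply, mul_apply]
  have htrace₂ : (A * P * B * P).trace =
      ∑ k, ∑ i, ∑ l, ∑ j, A k i * (P i l * (B l j * P j k)) := by
    simp only [mul_assoc, trace, diag_apply, mul_apply, Finset.mul_sum]
  rw [htrace A, htrace B, htrace₂]
  simp only [Finset.sum_mul]
  simp only [Finset.mul_sum, ← Finset.sum_add_distrib]
  refine Finset.sum_congr rfl fun k _ => Finset.sum_congr rfl fun i _ =>
    Finset.sum_congr rfl fun l _ => Finset.sum_congr rfl fun j _ => ?_
  ring

/-- The trace of a projector is the dimension of its range. -/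
theorem trace_eq_finrank {N : ℕ} {Q : Submodule ℂ (Fin N → ℂ)}
    {P : Matrix (Fin N) (Fin N) ℂ} (hPidem : P * P = P)
    (hPrange : ∀ v : Fin N → ℂ, v ∈ Q ↔ P.mulVec v = v) :
    P.trace = Module.finrank ℂ Q := by
  have hproj : LinearMap.IsProj Q P.toLin' :=
    ⟨fun x => (hPrange _).2 (by simp [mulVec_mulVec, hPidem]),
      fun x hx => by simpa using (hPrange x).1 hx⟩
  rw [← hproj.trace, Matrix.trace_toLin'_eq]

/-- For `Q ≤ ℂ^N` of dimension `K` with projector `P`, and any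
unitarily invariant probability measure on the unit vectors of `Q`, the variance of
`⟨ψ|E|ψ⟩` equals `[K·tr(EᴴPEP) − tr(EᴴP)tr(EP)] / [K²(K+1)]`. -/
theorem stmt_1 (N K : ℕ) (Q : Submodule ℂ (Fin N → ℂ))
    (hQK : Module.finrank ℂ Q = K)
    (P E : Matrix (Fin N) (Fin N) ℂ)
    (hPherm : P.IsHermitian) (hPidem : P * P = P)
    (hPrange : ∀ v : Fin N → ℂ, v ∈ Q ↔ P.mulVec v = v)
    (μ : Measure (Fin N → ℂ)) [IsProbabilityMeasure μ]
    (hsupp : ∀ᵐ ψ ∂μ, ψ ∈ Q ∧ star ψ ⬝ᵥ ψ = 1)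
    (hinv : ∀ U : Matrix (Fin N) (Fin N) ℂ, U ∈ Matrix.unitaryGroup (Fin N) ℂ →
      (∀ v ∈ Q, U.mulVec v ∈ Q) → μ.map U.mulVec = μ) :
    (↑(∫ ψ, ‖(star ψ ⬝ᵥ E.mulVec ψ) - ∫ φ, (star φ ⬝ᵥ E.mulVec φ) ∂μ‖ ^ 2 ∂μ) : ℂ) =
      ((K : ℂ) * (Eᴴ * P * E * P).trace - (Eᴴ * P).trace * (E * P).trace) /
        ((K : ℂ) ^ 2 * ((K : ℂ) + 1)) := by
  have hunit : ∀ᵐ ψ ∂μ, star ψ ⬝ᵥ ψ = 1 := hsupp.mono fun _ h => h.2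
  obtain ⟨a, ha⟩ := exists_fourthMoment_eq hPherm hPidem hPrange hsupp hinv
  have hmul := integral_quadraticForm_mul hunit ha
  have hint (A : Matrix (Fin N) (Fin N) ℂ) :=
    integrable_of_ae_unit hunit (continuous_quadraticForm A)
  have htr : P.trace = K := by rw [trace_eq_finrank hPidem hPrange, hQK]
  have hone : a * (K * (K + 1)) = 1 := by
    have h := hmul 1 1
    simp only [one_mul, mul_one, one_mulVec, hPidem, htr] at h
    have h1 : ∫ ψ : Fin N → ℂ, (star ψ ⬝ᵥ ψ) * (star ψ ⬝ᵥ ψ) ∂μ = 1 := by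
      rw [integral_congr_ae (g := fun _ => (1 : ℂ)) (hunit.mono fun ψ hψ => by simp [hψ])]
      simp
    linear_combination h1 - h
  have hK : (K : ℂ) ≠ 0 := by
    rintro h
    simp [h] at hone
  have hK1 : (K : ℂ) + 1 ≠ 0 := by exact_mod_cast K.succ_ne_zero
  have hmean (A : Matrix (Fin N) (Fin N) ℂ) :
      ∫ ψ, star ψ ⬝ᵥ A.mulVec ψ ∂μ = (A * P).trace / K := by
    have h := hmul A 1
    rw [one_mul, mul_one, htr, mul_assoc A P P, hPidem] at h
    rw [eq_div_iff hK, integral_congr_ae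
      (g := fun ψ => (star ψ ⬝ᵥ A.mulVec ψ) * (star ψ ⬝ᵥ (1 : Matrix _ _ ℂ).mulVec ψ))
      (hunit.mono fun ψ hψ => by simp [hψ]), h]
    linear_combination (A * P).trace * hone
  have hconj (ψ : Fin N → ℂ) :
      star (star ψ ⬝ᵥ E.mulVec ψ) = star ψ ⬝ᵥ Eᴴ.mulVec ψ := by
    rw [← star_dotProduct_star, star_star, star_mulVec, ← dotProduct_mulVec]
  set m := ∫ φ, (star φ ⬝ᵥ E.mulVec φ) ∂μ with hm
  have hmconj : star m = (Eᴴ * P).trace / K := by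
    rw [← hmean, hm, Complex.star_def, ← integral_conj]
    simp only [← hconj, Complex.star_def]
  have hexp (ψ : Fin N → ℂ) : ((‖(star ψ ⬝ᵥ E.mulVec ψ) - m‖ ^ 2 : ℝ) : ℂ) =
      (star ψ ⬝ᵥ Eᴴ.mulVec ψ) * (star ψ ⬝ᵥ E.mulVec ψ) - star m * (star ψ ⬝ᵥ E.mulVec ψ) -
        m * (star ψ ⬝ᵥ Eᴴ.mulVec ψ) + star m * m := by
    rw [Complex.ofReal_pow, ← Complex.conj_mul', ← Complex.star_def, star_sub, hconj]
    ring
  have hmulint : Integrable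
      (fun ψ => (star ψ ⬝ᵥ Eᴴ.mulVec ψ) * (star ψ ⬝ᵥ E.mulVec ψ)) μ :=
    integrable_of_ae_unit hunit
      ((continuous_quadraticForm _).mul (continuous_quadraticForm _))
  rw [← integral_complex_ofReal]
  simp only [hexp]
  have hint₁ := (hint E).const_mul (star m)
  have hint₂ := (hint Eᴴ).const_mul m
  rw [integral_add (by exact (hmulint.sub hint₁).sub hint₂) (integrable_const _),
    integral_sub (by exact hmulint.sub hint₁) hint₂, integral_sub hmulint hint₁,
    integral_const_mul, integral_const_mul, hmul, ← hm, hmean Eᴴ, hmconj, hm, hmean E]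
  have haK : a = 1 / (K * (K + 1)) := by
    rw [eq_div_iff (mul_ne_zero hK hK1), hone]
  rw [haK]
  simp
  field_simp
  ring
end

section
/- Let Q ≤ C^N be a subspace of dimension K with projector P. A linear operator E satisfies ⟨ψ|E|ψ⟩ = ⟨φ|E|φ⟩ for all unit vectors ψ, φ ∈ Q (i.e., E is detectable by Q) if and only if K·tr(E†PEP) = tr(E†P)·tr(EP). -/
open Matrix

/-- A complex matrix with vanishing quadratic form is zero. -/
theorem Matrix.eq_zero_of_forall_star_dotProduct_mulVec {n : Type*} [Fintype n] [DecidableEq n]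
    {M : Matrix n n ℂ} (h : ∀ v : n → ℂ, star v ⬝ᵥ M *ᵥ v = 0) : M = 0 := by
  have h_lin : Matrix.toEuclideanLin M = 0 := by
    rw [← inner_map_self_eq_zero]
    intro x
    have hx := h x.ofLp
    rw [← map_eq_zero (starRingEnd ℂ), inner_conj_symm, EuclideanSpace.inner_eq_star_dotProduct,
      dotProduct_comm]
    exact hx
  exact (map_eq_zero_iff _ (Matrix.toEuclideanLin).injective).1 h_lin

/-- The trace of an idempotent matrix is the dimension of its space of fixed vectors. -/
theorem Matrix.trace_eq_finrank_of_forall_mem_iff {n : Type*} [Fintype n] [DecidableEq n]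
    {P : Matrix n n ℂ} (hP : P * P = P) (Q : Submodule ℂ (n → ℂ))
    (hQ : ∀ v : n → ℂ, v ∈ Q ↔ P *ᵥ v = v) : P.trace = (Module.finrank ℂ Q : ℂ) := by
  have h_proj : LinearMap.IsProj Q (Matrix.toLin' P) :=
    ⟨fun x => (hQ _).2 (by simp [Matrix.toLin'_apply, Matrix.mulVec_mulVec, hP]),
      fun x hx => (hQ x).1 hx⟩
  rw [← h_proj.trace, Matrix.trace_toLin'_eq]

open scoped ComplexOrder in
/-- Detectability says that the compression of `E` to `Q` is a multiple of the projector. -/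
theorem compression_eq_smul_of_detectable {n : Type*} [Fintype n] [DecidableEq n]
    (Q : Submodule ℂ (n → ℂ)) {P E : Matrix n n ℂ}
    (hPherm : P.IsHermitian) (hPidem : P * P = P)
    (hQ : ∀ v : n → ℂ, v ∈ Q ↔ P *ᵥ v = v)
    (h : ∀ ψ φ : n → ℂ, ψ ∈ Q → φ ∈ Q → star ψ ⬝ᵥ ψ = 1 → star φ ⬝ᵥ φ = 1 →
        star ψ ⬝ᵥ E *ᵥ ψ = star φ ⬝ᵥ E *ᵥ φ) :
    ∃ c : ℂ, P * E * P = c • P := by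
  obtain ⟨c, hc⟩ : ∃ c : ℂ, ∀ ψ ∈ Q, star ψ ⬝ᵥ ψ = 1 → star ψ ⬝ᵥ E *ᵥ ψ = c := by
    by_cases hex : ∃ φ ∈ Q, star φ ⬝ᵥ φ = 1
    · obtain ⟨φ, hφ, hφ1⟩ := hex
      exact ⟨_, fun ψ hψ hψ1 => h ψ φ hψ hφ hψ1 hφ1⟩
    · exact ⟨0, fun ψ hψ hψ1 => absurd ⟨ψ, hψ, hψ1⟩ hex⟩
  have h_scale : ∀ w ∈ Q, star w ⬝ᵥ E *ᵥ w = c * (star w ⬝ᵥ w) := by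
    intro w hw
    by_cases hw0 : w = 0
    · simp [hw0]
    obtain ⟨r, hr, hrw⟩ : ∃ r : ℝ, 0 < r ∧ star w ⬝ᵥ w = ((r ^ 2 : ℝ) : ℂ) := by
      have hpos : 0 < star w ⬝ᵥ w := Matrix.dotProduct_star_self_pos_iff.2 hw0
      obtain ⟨hre, him⟩ := Complex.pos_iff.1 hpos
      refine ⟨√(star w ⬝ᵥ w).re, Real.sqrt_pos.2 hre, ?_⟩
      rw [Real.sq_sqrt hre.le]
      exact Complex.ext rfl (by simpa using him.symm)
    have hr0 : (r : ℂ) ≠ 0 := by exact_mod_cast hr.ne'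
    have hu := hc ((r : ℂ)⁻¹ • w) (Q.smul_mem _ hw) (by
      simp only [star_smul, smul_dotProduct, dotProduct_smul, hrw, smul_eq_mul, star_inv₀,
        Complex.star_def, Complex.conj_ofReal]
      push_cast
      field_simp)
    simp only [star_smul, smul_dotProduct, dotProduct_smul, mulVec_smul, smul_eq_mul, star_inv₀,
      Complex.star_def, Complex.conj_ofReal] at hu
    rw [hrw, ← hu]
    push_cast
    field_simp
  refine ⟨c, sub_eq_zero.1 (Matrix.eq_zero_of_forall_star_dotProduct_mulVec fun v => ?_)⟩
  have hv := h_scale (P *ᵥ v) ((hQ _).2 (by rw [mulVec_mulVec, hPidem]))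
  simp only [star_mulVec, hPherm.eq, ← dotProduct_mulVec, mulVec_mulVec, hPidem] at hv
  rw [sub_mulVec, dotProduct_sub, smul_mulVec, dotProduct_smul, smul_eq_mul, ← hv, Matrix.mul_assoc,
    sub_self]

/-- Let `Q ≤ ℂ^N` be a subspace of dimension `K` with orthogonal
projector `P`.  A linear operator `E` is detectable by `Q` (i.e. `⟨ψ|E|ψ⟩` takes the
same value on all unit vectors of `Q`) iff `K·tr(EᴴPEP) = tr(EᴴP)·tr(EP)`. -/
theorem stmt_2 (N K : ℕ) (Q : Submodule ℂ (Fin N → ℂ))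
    (hQK : Module.finrank ℂ Q = K)
    (P E : Matrix (Fin N) (Fin N) ℂ)
    (hPherm : P.IsHermitian) (hPidem : P * P = P)
    (hPrange : ∀ v : Fin N → ℂ, v ∈ Q ↔ P.mulVec v = v) :
    (∀ ψ φ : Fin N → ℂ, ψ ∈ Q → φ ∈ Q →
        star ψ ⬝ᵥ ψ = 1 → star φ ⬝ᵥ φ = 1 →
        star ψ ⬝ᵥ E.mulVec ψ = star φ ⬝ᵥ E.mulVec φ)
      ↔ (K : ℂ) * (Eᴴ * P * E * P).trace = (Eᴴ * P).trace * (E * P).trace := by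
  have h_trP : P.trace = (K : ℂ) := hQK ▸ Matrix.trace_eq_finrank_of_forall_mem_iff hPidem Q hPrange
  have h_adj : (P * E * P)ᴴ = P * Eᴴ * P := by
    simp only [conjTranspose_mul, hPherm.eq, Matrix.mul_assoc]
  have h_comp : ∀ M : Matrix (Fin N) (Fin N) ℂ, (P * M * P).trace = (M * P).trace := fun M => by
    rw [trace_mul_comm, ← Matrix.mul_assoc, hPidem, trace_mul_comm]
  have h_sq : (Eᴴ * P * E * P).trace = ((P * E * P)ᴴ * (P * E * P)).trace := by
    have h_prod : (P * E * P)ᴴ * (P * E * P) = P * (Eᴴ * P * E) * P := by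
      rw [h_adj]
      calc P * Eᴴ * P * (P * E * P) = P * Eᴴ * (P * P) * E * P := by
            simp only [Matrix.mul_assoc]
        _ = P * (Eᴴ * P * E) * P := by
            rw [hPidem]
            simp only [Matrix.mul_assoc]
    rw [h_prod, h_comp]
  rw [h_sq, ← h_comp E, ← h_comp Eᴴ, ← h_adj]
  constructor
  · intro h
    obtain ⟨c, hc⟩ := compression_eq_smul_of_detectable Q hPherm hPidem hPrange h
    simp only [hc, conjTranspose_smul, hPherm.eq, smul_mul_smul_comm, hPidem, trace_smul, h_trP,
      smul_eq_mul]
    ring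
  · intro h ψ φ hψ hφ hψ1 hφ1
    set A := P * E * P with hA
    have hAP : Aᴴ * P = Aᴴ := by
      rw [h_adj, Matrix.mul_assoc, hPidem]
    have hPA : P * A = A := by
      rw [hA, ← Matrix.mul_assoc, ← Matrix.mul_assoc, hPidem]
    have h_zero : (K : ℂ) • A - A.trace • P = 0 := by
      open scoped ComplexOrder in rw [← trace_conjTranspose_mul_self_eq_zero_iff]
      simp only [conjTranspose_sub, conjTranspose_smul, hPherm.eq, sub_mul, mul_sub,
        smul_mul_smul_comm, hAP, hPA, hPidem, trace_sub, trace_smul, h_trP, smul_eq_mul, star_natCast]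
      rw [trace_conjTranspose] at h ⊢
      linear_combination (K : ℂ) * h
    have h_form : ∀ χ ∈ Q, star χ ⬝ᵥ χ = 1 → (K : ℂ) * (star χ ⬝ᵥ E *ᵥ χ) = A.trace := by
      intro χ hχ hχ1
      have hPχ := (hPrange χ).1 hχ
      have hEχ : star χ ⬝ᵥ A *ᵥ χ = star χ ⬝ᵥ E *ᵥ χ := by
        have hχP : star χ ᵥ* P = star χ := by
          conv_rhs => rw [← hPχ, star_mulVec, hPherm.eq]
        rw [hA, ← mulVec_mulVec, hPχ, ← mulVec_mulVec, dotProduct_mulVec, hχP]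
      have h_quad : star χ ⬝ᵥ ((K : ℂ) • A - A.trace • P) *ᵥ χ = 0 := by
        rw [h_zero, zero_mulVec, dotProduct_zero]
      rw [sub_mulVec, smul_mulVec, smul_mulVec, hPχ, dotProduct_sub, dotProduct_smul,
        dotProduct_smul, hχ1, hEχ, smul_eq_mul, smul_eq_mul, mul_one, sub_eq_zero] at h_quad
      exact h_quad
    have hK : (K : ℂ) ≠ 0 := by
      rw [← hQK, Nat.cast_ne_zero]
      intro h0
      have hψ0 : ψ = 0 := by
        rw [Submodule.finrank_eq_zero.1 h0] at hψ
        simpa using hψ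
      simp [hψ0] at hψ1
    exact mul_left_cancel₀ hK ((h_form ψ hψ hψ1).trans (h_form φ hφ hφ1).symm)
end

section
/- With A_S'(P) = K^{−2} tr_S[(tr_{S'}P)²] for a rank-K projector P on (C^D)^{⊗n}, if T ⊆ S ⊆ {1,…,n} then D^{|T|−|S|} A_T'(P) ≤ A_S'(P) ≤ D^{|S|−|T|} A_T'(P). -/
open Matrix

noncomputable section

/-- Interleave a configuration on the qudits in `S` with one on the complement. -/
def glue {n : ℕ} {α : Type*} (S : Finset (Fin n)) (u : {i // i ∈ S} → α)
    (v : {i // i ∉ S} → α) : Fin n → α :=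
  fun i => if h : i ∈ S then u ⟨i, h⟩ else v ⟨i, h⟩

/-- Partial trace over the qudits indexed by `S` of an operator on `(ℂ^α)^{⊗n}`. -/
def ptr {n : ℕ} {α : Type*} [Fintype α] (S : Finset (Fin n))
    (M : Matrix (Fin n → α) (Fin n → α) ℂ) :
    Matrix ({i // i ∉ S} → α) ({i // i ∉ S} → α) ℂ :=
  fun v w => ∑ u : {i : Fin n // i ∈ S} → α, M (glue S u v) (glue S u w)

/-- Rains enumerator `A_S'(P) = K⁻² tr_S[(tr_{S'}P)²]` (a real quantity). -/
def Arains {n D : ℕ} (K : ℕ) (S : Finset (Fin n))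
    (P : Matrix (Fin n → Fin D) (Fin n → Fin D) ℂ) : ℝ :=
  (1 / (K : ℝ) ^ 2) * ((ptr Sᶜ P * ptr Sᶜ P).trace).re

/-- Rains enumerator `B_S'(P) = K⁻¹ tr_{S'}[(tr_S P)²]` (a real quantity). -/
def Brains {n D : ℕ} (K : ℕ) (S : Finset (Fin n))
    (P : Matrix (Fin n → Fin D) (Fin n → Fin D) ℂ) : ℝ :=
  (1 / (K : ℝ)) * ((ptr S P * ptr S P).trace).re

/-- Cauchy–Schwarz for partial traces: tracing out `u` multiplies the squared Frobenius norm by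
at most the dimension of the traced-out factor. -/
theorem sum_normSq_partialTrace_le {A U : Type*} [Fintype A] [Fintype U]
    (R : A × U → A × U → ℂ) :
    ∑ a, ∑ a', ‖∑ u, R (a, u) (a', u)‖ ^ 2 ≤
      (Fintype.card U : ℝ) * ∑ x, ∑ y, ‖R x y‖ ^ 2 := by
  have hcs (a a' : A) : ‖∑ u, R (a, u) (a', u)‖ ^ 2 ≤
      (Fintype.card U : ℝ) * ∑ u, ∑ u', ‖R (a, u) (a', u')‖ ^ 2 := by
    calc ‖∑ u, R (a, u) (a', u)‖ ^ 2 ≤ (∑ u, ‖R (a, u) (a', u)‖) ^ 2 := by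
          gcongr
          exact norm_sum_le _ _
      _ ≤ (Fintype.card U : ℝ) * ∑ u, ‖R (a, u) (a', u)‖ ^ 2 :=
          sq_sum_le_card_mul_sum_sq
      _ ≤ _ := by
          gcongr with u
          exact Finset.single_le_sum (f := fun u' => ‖R (a, u) (a', u')‖ ^ 2)
            (fun _ _ => by positivity) (Finset.mem_univ u)
  calc ∑ a, ∑ a', ‖∑ u, R (a, u) (a', u)‖ ^ 2
      ≤ ∑ a, ∑ a', (Fintype.card U : ℝ) * ∑ u, ∑ u', ‖R (a, u) (a', u')‖ ^ 2 := by
        gcongr with a _ a' _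
        exact hcs a a'
    _ = (Fintype.card U : ℝ) * ∑ x, ∑ y, ‖R x y‖ ^ 2 := by
        simp only [← Finset.mul_sum, Fintype.sum_prod_type]
        congr 1
        exact Finset.sum_congr rfl fun a _ => Finset.sum_comm

/-- The squared Frobenius norm of a Hermitian matrix is the trace of its square. -/
theorem re_trace_mul_self_of_isHermitian {C : Type*} [Fintype C] {R : Matrix C C ℂ}
    (hR : R.IsHermitian) : (R * R).trace.re = ∑ c, ∑ c', ‖R c c'‖ ^ 2 := by
  simp only [Matrix.trace, Matrix.diag, Matrix.mul_apply, Complex.re_sum]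
  refine Finset.sum_congr rfl fun c _ => Finset.sum_congr rfl fun c' _ => ?_
  rw [← hR.apply c' c, Complex.star_def, Complex.mul_conj, Complex.ofReal_re,
    Complex.normSq_eq_norm_sq]

/-- The two Gram matrices of a rectangular matrix have the same Frobenius norm. -/
theorem sum_normSq_gram_comm {A B : Type*} [Fintype A] [Fintype B] (M : A → B → ℂ) :
    ∑ a, ∑ a', ‖∑ b, M a b * star (M a' b)‖ ^ 2 =
      ∑ b, ∑ b', ‖∑ a, M a b * star (M a b')‖ ^ 2 := by
  have h₁ := re_trace_mul_self_of_isHermitian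
    (Matrix.isHermitian_mul_conjTranspose_self (Matrix.of M))
  have h₂ := re_trace_mul_self_of_isHermitian
    (Matrix.isHermitian_conjTranspose_mul_self (Matrix.of M))
  have h : (Matrix.of M * (Matrix.of M)ᴴ * (Matrix.of M * (Matrix.of M)ᴴ)).trace =
      ((Matrix.of M)ᴴ * Matrix.of M * ((Matrix.of M)ᴴ * Matrix.of M)).trace := by
    rw [Matrix.mul_assoc, Matrix.trace_mul_comm]
    simp only [Matrix.mul_assoc]
  rw [h, h₂] at h₁
  simp only [Matrix.mul_apply, Matrix.conjTranspose_apply, Matrix.of_apply] at h₁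
  rw [← h₁, Finset.sum_comm]
  simp only [mul_comm]

/-- Configurations on a disjoint union of two sets of sites are pairs of configurations. -/
def splitConfig {ι α : Type*} {p q r : ι → Prop} [DecidablePred q]
    (hp : ∀ i, p i ↔ q i ∨ r i) (hqr : ∀ i, q i → ¬ r i) :
    ({i // p i} → α) ≃ ({i // q i} → α) × ({i // r i} → α) where
  toFun x := (fun i => x ⟨i, (hp i).2 (.inl i.2)⟩, fun i => x ⟨i, (hp i).2 (.inr i.2)⟩)
  invFun y i := if h : q i then y.1 ⟨i, h⟩ else y.2 ⟨i, ((hp i).1 i.2).resolve_left h⟩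
  left_inv x := by
    ext i
    by_cases h : q i <;> simp [h]
  right_inv y := by
    ext i
    · simp [i.2]
    · have h : ¬ q i := fun h => hqr i h i.2
      simp [h]

theorem ptr_isHermitian {n : ℕ} {α : Type*} [Fintype α] (R : Finset (Fin n))
    {P : Matrix (Fin n → α) (Fin n → α) ℂ} (hP : P.IsHermitian) : (ptr R P).IsHermitian := by
  ext v w
  simp only [Matrix.conjTranspose_apply, ptr, star_sum, hP.apply]

/-- The purity of a partial trace, computed in any parametrisation of the traced-out and the
remaining configurations. -/
theorem re_trace_ptr_sq {n : ℕ} {α B C : Type*} [Fintype α] [Fintype B] [Fintype C]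
    {R : Finset (Fin n)} {P : Matrix (Fin n → α) (Fin n → α) ℂ} (hP : P.IsHermitian)
    (f : ({i // i ∈ R} → α) ≃ B) (g : ({i // i ∉ R} → α) ≃ C) (F : C → B → Fin n → α)
    (hF : ∀ u v, glue R u v = F (g v) (f u)) :
    (ptr R P * ptr R P).trace.re = ∑ c, ∑ c', ‖∑ b, P (F c b) (F c' b)‖ ^ 2 := by
  rw [re_trace_mul_self_of_isHermitian (ptr_isHermitian R hP)]
  refine Fintype.sum_equiv g _ _ fun v => Fintype.sum_equiv g _ _ fun w => ?_
  congr 2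
  refine Fintype.sum_equiv f _ _ fun u => ?_
  rw [hF, hF]

/-- Tracing out one more factor `U` of a positive operator `G` changes the purity by a factor of at
most `|U|`, in either direction. -/
theorem purity_bounds {A U V Z : Type*} [Fintype A] [Fintype U] [Fintype V] [Fintype Z]
    (Q : A × U × V → Z → ℂ) (G : A × U × V → A × U × V → ℂ)
    (hG : ∀ x y, G x y = ∑ z, Q x z * star (Q y z)) :
    (∑ a, ∑ a', ‖∑ b : U × V, G (a, b) (a', b)‖ ^ 2 ≤ (Fintype.card U : ℝ) *
      ∑ c : A × U, ∑ c' : A × U, ‖∑ v, G (c.1, c.2, v) (c'.1, c'.2, v)‖ ^ 2) ∧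
    (∑ c : A × U, ∑ c' : A × U, ‖∑ v, G (c.1, c.2, v) (c'.1, c'.2, v)‖ ^ 2 ≤
      (Fintype.card U : ℝ) * ∑ a, ∑ a', ‖∑ b : U × V, G (a, b) (a', b)‖ ^ 2) := by
  constructor
  · simpa only [Fintype.sum_prod_type (α₁ := U) (α₂ := V)] using
      sum_normSq_partialTrace_le fun c c' : A × U => ∑ v, G (c.1, c.2, v) (c'.1, c'.2, v)
  · have hS := sum_normSq_gram_comm fun (c : A × U) (d : V × Z) => Q (c.1, c.2, d.1) d.2
    have hT := sum_normSq_gram_comm fun (a : A) (d : (V × Z) × U) => Q (a, d.2, d.1.1) d.1.2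
    have h := sum_normSq_partialTrace_le fun d d' : (V × Z) × U =>
      ∑ a, Q (a, d.2, d.1.1) d.1.2 * star (Q (a, d'.2, d'.1.1) d'.1.2)
    rw [← hT] at h
    have hS' : ∀ c c' : A × U, ∑ v, G (c.1, c.2, v) (c'.1, c'.2, v) =
        ∑ d : V × Z, Q (c.1, c.2, d.1) d.2 * star (Q (c'.1, c'.2, d.1) d.2) := fun c c' => by
      simp only [hG, Fintype.sum_prod_type]
    have hT' : ∀ a a' : A, ∑ b : U × V, G (a, b) (a', b) =
        ∑ d : (V × Z) × U, Q (a, d.2, d.1.1) d.1.2 * star (Q (a', d.2, d.1.1) d.1.2) :=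
      fun a a' => by
        simp only [hG, ← Fintype.sum_prod_type']
        exact Fintype.sum_equiv
          ((Equiv.prodAssoc U V Z).trans (Equiv.prodComm U (V × Z))) _ _ fun _ => rfl
    simp only [hS', hT', hS]
    refine le_trans (le_of_eq ?_) h
    refine Finset.sum_congr rfl fun d _ => Finset.sum_congr rfl fun d' _ => ?_
    rw [Fintype.sum_prod_type_right]

theorem re_trace_ptr_compl_sq_bounds {n D : ℕ}
    {P : Matrix (Fin n → Fin D) (Fin n → Fin D) ℂ}
    (hPherm : P.IsHermitian) (hPidem : P * P = P) {T S : Finset (Fin n)} (hTS : T ⊆ S) :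
    (ptr Tᶜ P * ptr Tᶜ P).trace.re ≤
        (D : ℝ) ^ (S.card - T.card) * (ptr Sᶜ P * ptr Sᶜ P).trace.re ∧
      (ptr Sᶜ P * ptr Sᶜ P).trace.re ≤
        (D : ℝ) ^ (S.card - T.card) * (ptr Tᶜ P * ptr Tᶜ P).trace.re := by
  let F (x : ({i // i ∈ T} → Fin D) × ({i // i ∈ S \ T} → Fin D) × ({i // i ∈ Sᶜ} → Fin D)) :
      Fin n → Fin D := fun i =>
    if hT : i ∈ T then x.1 ⟨i, hT⟩
    else if hS : i ∈ S then x.2.1 ⟨i, Finset.mem_sdiff.2 ⟨hS, hT⟩⟩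
    else x.2.2 ⟨i, Finset.mem_compl.2 hS⟩
  have hcard : (Fintype.card ({i // i ∈ S \ T} → Fin D) : ℝ) = (D : ℝ) ^ (S.card - T.card) := by
    rw [Fintype.card_fun, Fintype.card_fin, Fintype.card_coe, Finset.card_sdiff_of_subset hTS,
      Nat.cast_pow]
  have hS := re_trace_ptr_sq (R := Sᶜ) hPherm (Equiv.refl _)
    (splitConfig (q := (· ∈ T)) (r := (· ∈ S \ T))
      (by grind [Finset.mem_compl]) (by grind))
    (fun c v => F (c.1, c.2, v)) (by
      intro u v
      ext i
      by_cases h₁ : i ∈ T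
      · have h₂ := hTS h₁
        simp [F, glue, splitConfig, h₁, h₂]
      · by_cases h₂ : i ∈ S <;> simp [F, glue, splitConfig, h₁, h₂])
  have hT := re_trace_ptr_sq (R := Tᶜ) hPherm
    (splitConfig (q := (· ∈ S \ T)) (r := (· ∈ Sᶜ))
      (by grind [Finset.mem_compl]) (by grind [Finset.mem_compl]))
    ((Equiv.subtypeEquivRight (q := (· ∈ T)) (by simp)).arrowCongr (Equiv.refl _))
    (fun a b => F (a, b)) (by
      intro u v
      ext i
      by_cases h₁ : i ∈ T
      · simp [F, glue, splitConfig, h₁]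
        rfl
      · by_cases h₂ : i ∈ S <;> simp [F, glue, splitConfig, h₁, h₂])
  rw [hS, hT, ← hcard]
  refine purity_bounds (fun x z => P (F x) z) (fun x y => P (F x) (F y)) fun x y => ?_
  conv_lhs => rw [← hPidem, Matrix.mul_apply]
  simp only [hPherm.apply]

/-- For a rank-`K` projector `P` on `(ℂ^D)^{⊗n}` and `T ⊆ S`:
`D^{|T|−|S|} A_T'(P) ≤ A_S'(P) ≤ D^{|S|−|T|} A_T'(P)`. -/
theorem stmt_9 (n D K : ℕ) (hD : 0 < D)
    (P : Matrix (Fin n → Fin D) (Fin n → Fin D) ℂ)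
    (hPherm : P.IsHermitian) (hPidem : P * P = P) (hPtr : P.trace = (K : ℂ))
    (T S : Finset (Fin n)) (hTS : T ⊆ S) :
    (D : ℝ) ^ ((T.card : ℤ) - (S.card : ℤ)) * Arains K T P ≤ Arains K S P ∧
      Arains K S P ≤ (D : ℝ) ^ ((S.card : ℤ) - (T.card : ℤ)) * Arains K T P := by
  obtain ⟨h₁, h₂⟩ := re_trace_ptr_compl_sq_bounds hPherm hPidem hTS
  have hcard := Finset.card_le_card hTS
  have hD' : (0 : ℝ) < (D : ℝ) ^ (S.card - T.card) := by positivity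
  have hexp : ((S.card : ℤ) - (T.card : ℤ)) = ((S.card - T.card : ℕ) : ℤ) := by omega
  have hexp' : ((T.card : ℤ) - (S.card : ℤ)) = -((S.card - T.card : ℕ) : ℤ) := by omega
  have hK : (0 : ℝ) ≤ 1 / (K : ℝ) ^ 2 := by positivity
  rw [hexp, hexp', _root_.zpow_neg, _root_.zpow_natCast]
  simp only [Arains]
  constructor
  · rw [inv_mul_le_iff₀ hD', mul_left_comm]
    exact mul_le_mul_of_nonneg_left h₁ hK
  · rw [mul_left_comm]
    exact mul_le_mul_of_nonneg_left h₂ hK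

end
end

section
/- For an [[n,k]]_D stabilizer code with stabilizer S (an abelian subgroup of the error group containing the center Z = {e^{2πiγ/D'}I}), the enumerators satisfy A_S'(P) = |{E ∈ S : supp(E) ⊆ S}| / (D^{|S|} D') and B_S'(P) = |{E ∈ C(S) : supp(E) ⊆ S}| / (D^{|S|} D'), where C(S) is the centralizer of S in the error group and P = |S|^{−1} Σ_{E∈S} λ₀(E)^{−1} E is the code projector. -/
open Matrix Complex

noncomputable section

/-- An operator on `(ℂ^α)^{⊗n}` supported in `S` (of the form `M ⊗ I`). -/
def SupportedIn {n : ℕ} {α : Type*} [Fintype α] [DecidableEq α] (S : Finset (Fin n))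
    (E : Matrix (Fin n → α) (Fin n → α) ℂ) : Prop :=
  ∃ M : Matrix ({i // i ∈ S} → α) ({i // i ∈ S} → α) ℂ,
    ∀ f g : Fin n → α,
      E f g =
        if (fun i : {i // i ∉ S} => f i) = (fun i : {i // i ∉ S} => g i) then
          M (fun i : {i // i ∈ S} => f i) (fun i : {i // i ∈ S} => g i)
        else 0

/-- The cyclic shift operator `X` on `ℂ^{D'}`. -/
def Xmat (D' : ℕ) : Matrix (Fin D') (Fin D') ℂ :=
  fun i j => if (i : ℕ) = ((j : ℕ) + 1) % D' then 1 else 0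

/-- The clock operator `Z` on `ℂ^{D'}`. -/
def Zmat (D' : ℕ) : Matrix (Fin D') (Fin D') ℂ :=
  Matrix.diagonal fun j : Fin D' => Complex.exp (2 * (Real.pi : ℂ) * Complex.I * (j : ℕ) / D')

/-- The single-(small-)qudit displacement operator `D(μ,ν) = e^{iπμν/D'} X^μ Z^ν`. -/
def Dmat (D' μ ν : ℕ) : Matrix (Fin D') (Fin D') ℂ :=
  Complex.exp ((Real.pi : ℂ) * Complex.I * μ * ν / D') • (Xmat D' ^ μ * Zmat D' ^ ν)

/-- Each of the `n` qudits of dimension `D = D'^l` is a block of `l` small qudits of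
prime dimension `D'`; the state space of one qudit is indexed by `Fin l → Fin D'`. -/
abbrev QIdx (D' l n : ℕ) := Fin n → (Fin l → Fin D')

/-- The multi-qudit displacement operator on `((ℂ^{D'})^{⊗l})^{⊗n}`. -/
def DnMat (D' l n : ℕ) (μ ν : QIdx D' l n) :
    Matrix (QIdx D' l n) (QIdx D' l n) ℂ :=
  fun f g => ∏ i : Fin n, ∏ j : Fin l, Dmat D' (μ i j) (ν i j) (f i j) (g i j)

/-- Membership in the error group: a phase `e^{2πiγ/D'} e^{iπμ·ν}` times a
displacement operator. -/
def errOp (D' l n : ℕ) (E : Matrix (QIdx D' l n) (QIdx D' l n) ℂ) : Prop :=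
  ∃ (γ : Fin D') (μ ν : QIdx D' l n),
    E = (Complex.exp (2 * (Real.pi : ℂ) * Complex.I * (γ : ℕ) / D') *
          Complex.exp ((Real.pi : ℂ) * Complex.I *
            ∑ i : Fin n, ∑ j : Fin l, ((μ i j : ℕ) : ℂ) * ((ν i j : ℕ) : ℂ))) •
        DnMat D' l n μ ν

/-- A symmetric nondegenerate bicharacter on an additive commutative group. -/
structure IsBichar {A : Type*} [AddCommGroup A] (b : A → A → ℂ) : Prop where
  map_zero : ∀ x, b x 0 = 1
  map_add : ∀ x y z, b x (y + z) = b x y * b x z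
  symm : ∀ x y, b x y = b y x
  nondeg : ∀ x, (∀ y, b x y = 1) → x = 0

namespace IsBichar

variable {A : Type*} [AddCommGroup A] {b : A → A → ℂ}

lemma zero_left (hb : IsBichar b) (x : A) : b 0 x = 1 := by
  rw [hb.symm, hb.map_zero]

lemma add_left (hb : IsBichar b) (x y z : A) : b (x + y) z = b x z * b y z := by
  rw [hb.symm, hb.map_add, hb.symm z x, hb.symm z y]

lemma mul_neg (hb : IsBichar b) (x y : A) : b x y * b x (-y) = 1 := by
  rw [← hb.map_add, add_neg_cancel, hb.map_zero]

lemma ne_zero (hb : IsBichar b) (x y : A) : b x y ≠ 0 :=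
  left_ne_zero_of_mul_eq_one (hb.mul_neg x y)

lemma neg_right (hb : IsBichar b) (x y : A) : b x (-y) = (b x y)⁻¹ :=
  eq_inv_of_mul_eq_one_right (hb.mul_neg x y)

lemma neg_left (hb : IsBichar b) (x y : A) : b (-x) y = (b x y)⁻¹ := by
  rw [hb.symm, hb.neg_right, hb.symm]

lemma eq_of_forall (hb : IsBichar b) {x y : A} (h : ∀ z, b x z = b y z) : x = y := by
  rw [← sub_eq_zero]
  refine hb.nondeg _ fun z => ?_
  rw [sub_eq_add_neg, hb.add_left, hb.neg_left, h, mul_inv_cancel₀ (hb.ne_zero _ _)]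

end IsBichar

/-- The product of a pairing over all coordinates. -/
def piPairing {ι A : Type*} [Fintype ι] (b : A → A → ℂ) (x y : ι → A) : ℂ :=
  ∏ i, b (x i) (y i)

lemma piPairing_single {ι A : Type*} [Fintype ι] [DecidableEq ι] [AddCommGroup A]
    {b : A → A → ℂ} (hb : IsBichar b) (x : ι → A) (i : ι) (a : A) :
    piPairing b x (Pi.single i a) = b (x i) a := by
  rw [piPairing, Finset.prod_eq_single i]
  · simp
  · intro j _ hj
    simp [hj, hb.map_zero]
  · simp

lemma IsBichar.pi {ι A : Type*} [Fintype ι] [DecidableEq ι] [AddCommGroup A]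
    {b : A → A → ℂ} (hb : IsBichar b) :
    IsBichar (piPairing b : (ι → A) → (ι → A) → ℂ) where
  map_zero x := by simp [piPairing, hb.map_zero]
  map_add x y z := by simp [piPairing, hb.map_add, Finset.prod_mul_distrib]
  symm x y := Finset.prod_congr rfl fun i _ => hb.symm _ _
  nondeg x h := by
    funext i
    refine hb.nondeg _ fun a => ?_
    rw [← piPairing_single hb x i a, h]

/-- The pairing `(x, y) ↦ ω ^ (x y)` on `Fin d`. -/
def finPairing {d : ℕ} (ω : ℂ) (x y : Fin d) : ℂ := ω ^ ((x : ℕ) * (y : ℕ))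

lemma isBichar_finPairing {d : ℕ} [NeZero d] {ω : ℂ} (hω : IsPrimitiveRoot ω d) (hd : 2 ≤ d) :
    IsBichar (finPairing ω : Fin d → Fin d → ℂ) where
  map_zero x := by simp [finPairing]
  map_add x y z := by
    rw [finPairing, finPairing, finPairing, ← pow_add, ← mul_add, Fin.val_add, pow_mul, pow_mul]
    refine (pow_eq_pow_mod _ ?_).symm
    rw [← pow_mul, mul_comm, pow_mul, hω.pow_eq_one, one_pow]
  symm x y := by rw [finPairing, finPairing, mul_comm]
  nondeg x h := by
    have h1 := h ⟨1, by omega⟩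
    simp only [finPairing, mul_one] at h1
    have := Nat.eq_zero_of_dvd_of_lt (hω.dvd_of_pow_eq_one _ h1) x.2
    exact Fin.ext (by simpa using this)

lemma sum_comp_of_injOn {ι : Type*} (s : Finset ι) (e : ι → ι) (φ : ι → ℂ)
    (hmem : ∀ x ∈ s, e x ∈ s) (hinj : Set.InjOn e s) : ∑ x ∈ s, φ (e x) = ∑ x ∈ s, φ x := by
  refine Finset.sum_bij (fun x _ => e x) hmem (fun x hx y hy h => hinj hx hy h) ?_
    fun _ _ => rfl
  exact fun y hy => by
    simpa [eq_comm] using Finset.surj_on_of_inj_on_of_card_le (fun x _ => e x) hmem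
      (fun x y hx hy h => hinj hx hy h) le_rfl y hy

lemma sum_eq_zero_of_scale {ι : Type*} (s : Finset ι) (e : ι → ι) (φ : ι → ℂ) {c : ℂ}
    (hc : c ≠ 1) (hmem : ∀ x ∈ s, e x ∈ s) (hinj : Set.InjOn e s)
    (hscale : ∀ x ∈ s, φ (e x) = c * φ x) : ∑ x ∈ s, φ x = 0 := by
  have h : ∑ x ∈ s, φ x = c * ∑ x ∈ s, φ x := by
    rw [Finset.mul_sum, ← Finset.sum_congr rfl hscale]
    exact (sum_comp_of_injOn s e φ hmem hinj).symm
  have h' : (1 - c) * ∑ x ∈ s, φ x = 0 := by linear_combination h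
  exact (mul_eq_zero.1 h').resolve_left (sub_ne_zero.2 hc.symm)

section Weyl

variable {G : Type*} [AddCommGroup G]

variable {β : G → G → ℂ}

/-- The phase picked up when commuting two Weyl operators. -/
def commPhase (β : G → G → ℂ) (a a' : G × G) : ℂ := β a.2 a'.1 * (β a'.2 a.1)⁻¹

lemma commPhase_add_left (hβ : IsBichar β) (a a' x : G × G) :
    commPhase β (a + a') x = commPhase β a x * commPhase β a' x := by
  simp only [commPhase, Prod.fst_add, Prod.snd_add, hβ.add_left, hβ.map_add, mul_inv]
  ring

lemma commPhase_add_right (hβ : IsBichar β) (x a a' : G × G) :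
    commPhase β x (a + a') = commPhase β x a * commPhase β x a' := by
  simp only [commPhase, Prod.fst_add, Prod.snd_add, hβ.add_left, hβ.map_add, mul_inv]
  ring

variable [DecidableEq G]

/-- The Weyl operator `X^μ Z^ν` attached to a pairing `β`. -/
def weyl (β : G → G → ℂ) (μ ν : G) : Matrix G G ℂ :=
  fun f g => if f = g + μ then β ν g else 0

lemma weyl_zero (hβ : IsBichar β) : weyl β (0 : G) 0 = 1 := by
  ext f g
  simp [weyl, hβ.zero_left, Matrix.one_apply]

lemma smul_weyl_inj (hβ : IsBichar β) {c c' : ℂ} {μ ν μ' ν' : G} (hc : c ≠ 0)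
    (h : c • weyl β μ ν = c' • weyl β μ' ν') : c = c' ∧ μ = μ' ∧ ν = ν' := by
  have key : ∀ g, c * β ν g = if g + μ = g + μ' then c' * β ν' g else 0 := fun g => by
    simpa [weyl] using congrFun (congrFun h (g + μ)) g
  have hμ : μ = μ' := by
    by_contra hne
    have := key 0
    rw [if_neg (by simpa using hne)] at this
    exact mul_ne_zero hc (hβ.ne_zero _ _) this
  subst hμ
  simp only [if_true] at key
  have hcc : c = c' := by simpa [hβ.map_zero] using key 0
  subst hcc
  exact ⟨rfl, rfl, hβ.eq_of_forall fun g => mul_left_cancel₀ hc (key g)⟩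

variable [Fintype G]

lemma weyl_mul (hβ : IsBichar β) (μ ν μ' ν' : G) :
    weyl β μ ν * weyl β μ' ν' = β ν μ' • weyl β (μ + μ') (ν + ν') := by
  ext f g
  simp only [Matrix.mul_apply, weyl, Matrix.smul_apply, smul_eq_mul]
  rw [Finset.sum_eq_single (g + μ')]
  · have : f = g + μ' + μ ↔ f = g + (μ + μ') := by rw [add_assoc, add_comm μ']
    by_cases h : f = g + (μ + μ')
    · rw [if_pos (this.2 h), if_pos h, if_pos rfl, hβ.map_add, hβ.add_left]
      ring
    · rw [if_neg (this.not.2 h), if_neg h]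
      simp
  · intro h _ hh
    simp [hh]
  · simp

lemma trace_weyl (hβ : IsBichar β) (μ ν : G) :
    (weyl β μ ν).trace = if μ = 0 ∧ ν = 0 then (Fintype.card G : ℂ) else 0 := by
  by_cases hμ : μ = 0
  · by_cases hν : ν = 0
    · subst hμ hν
      simp [weyl_zero hβ]
    · obtain ⟨y, hy⟩ : ∃ y, β ν y ≠ 1 := by
        by_contra! h
        exact hν (hβ.nondeg _ h)
      simp only [Matrix.trace, Matrix.diag, weyl, hμ, hν]
      simp only [add_zero, if_true, and_false, if_false]
      refine sum_eq_zero_of_scale Finset.univ (fun x => y + x) (β ν) hy (by simp)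
        (fun a _ c _ h => add_left_cancel h) fun x _ => hβ.map_add _ _ _
  · simp [Matrix.trace, weyl, hμ]

lemma weyl_mul_comm (hβ : IsBichar β) (μ ν μ' ν' : G) :
    weyl β μ ν * weyl β μ' ν' = commPhase β (μ, ν) (μ', ν') • (weyl β μ' ν' * weyl β μ ν) := by
  rw [weyl_mul hβ, weyl_mul hβ, smul_smul, add_comm μ', add_comm ν', commPhase,
    inv_mul_cancel_right₀ (hβ.ne_zero _ _)]

lemma weyl_comm_iff (hβ : IsBichar β) {c c' : ℂ} (hc : c ≠ 0) (hc' : c' ≠ 0) (a a' : G × G) :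
    (c • weyl β a.1 a.2) * (c' • weyl β a'.1 a'.2) =
      (c' • weyl β a'.1 a'.2) * (c • weyl β a.1 a.2) ↔ commPhase β a a' = 1 := by
  simp only [Matrix.smul_mul, Matrix.mul_smul, smul_smul, weyl_mul hβ,
    add_comm a'.1, add_comm a'.2]
  have hne := hβ.ne_zero a'.2 a.1
  constructor
  · intro h
    have := (smul_weyl_inj hβ (mul_ne_zero hc' (mul_ne_zero hc (hβ.ne_zero _ _))) h).1
    rw [mul_left_comm] at this
    rw [commPhase, mul_left_cancel₀ hc' (mul_left_cancel₀ hc this), mul_inv_cancel₀ hne]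
  · intro h
    rw [commPhase, mul_inv_eq_one₀ hne] at h
    rw [h, mul_left_comm]

lemma isUnit_smul_weyl (hβ : IsBichar β) {c : ℂ} (hc : c ≠ 0) (μ ν : G) :
    IsUnit (c • weyl β μ ν) := by
  refine IsUnit.of_mul_eq_one ((c⁻¹ * β ν μ) • weyl β (-μ) (-ν)) ?_
  rw [Matrix.smul_mul, Matrix.mul_smul, weyl_mul hβ, smul_smul, smul_smul, hβ.neg_right,
    add_neg_cancel, add_neg_cancel, weyl_zero hβ]
  have := hβ.ne_zero ν μ
  rw [show c * (c⁻¹ * β ν μ) * (β ν μ)⁻¹ = 1 by field_simp, one_smul]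

/-- `a` and `c` are the labels and the phases of the Weyl operators in `s`. -/
def IsLabelling (β : G → G → ℂ) (s : Finset (Matrix G G ℂ)) (a : Matrix G G ℂ → G × G)
    (c : Matrix G G ℂ → ℂ) : Prop :=
  ∀ E ∈ s, c E ≠ 0 ∧ E = c E • weyl β (a E).1 (a E).2

variable {s : Finset (Matrix G G ℂ)} {a : Matrix G G ℂ → G × G} {c : Matrix G G ℂ → ℂ}

lemma IsLabelling.isUnit (hβ : IsBichar β) (ha : IsLabelling β s a c) {E : Matrix G G ℂ}
    (hE : E ∈ s) : IsUnit E := by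
  rw [(ha E hE).2]
  exact isUnit_smul_weyl hβ (ha E hE).1 _ _

lemma IsLabelling.injOn_mul (hβ : IsBichar β) (ha : IsLabelling β s a c) {E : Matrix G G ℂ}
    (hE : E ∈ s) : Set.InjOn (E * ·) s :=
  fun _ _ _ _ h => (ha.isUnit hβ hE).mul_left_cancel h

lemma IsLabelling.map_mul (hβ : IsBichar β) (ha : IsLabelling β s a c) {E F : Matrix G G ℂ}
    (hE : E ∈ s) (hF : F ∈ s) (hEF : E * F ∈ s) : a (E * F) = a E + a F := by
  have h := (ha _ hEF).2
  nth_rewrite 1 [(ha E hE).2, (ha F hF).2] at h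
  rw [Matrix.smul_mul, Matrix.mul_smul, weyl_mul hβ, smul_smul, smul_smul] at h
  have h' := smul_weyl_inj hβ
    (mul_ne_zero (mul_ne_zero (ha E hE).1 (ha F hF).1) (hβ.ne_zero _ _)) h
  exact (Prod.ext h'.2.1 h'.2.2).symm

lemma IsLabelling.sum_commPhase (hβ : IsBichar β) (ha : IsLabelling β s a c)
    (hmul : ∀ E ∈ s, ∀ F ∈ s, E * F ∈ s) (x : G × G)
    [Decidable (∀ E ∈ s, commPhase β x (a E) = 1)] :
    ∑ E ∈ s, commPhase β x (a E) =
      if ∀ E ∈ s, commPhase β x (a E) = 1 then (s.card : ℂ) else 0 := by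
  split_ifs with h
  · simp [Finset.sum_congr rfl h]
  · push Not at h
    obtain ⟨E, hE, hne⟩ := h
    refine sum_eq_zero_of_scale s (E * ·) _ hne (fun F hF => hmul E hE F hF)
      (ha.injOn_mul hβ hE) fun F hF => ?_
    rw [ha.map_mul hβ hE hF (hmul E hE F hF), commPhase_add_right hβ]

end Weyl

section Qudits

variable {n : ℕ} {α : Type*}

lemma glue_of_mem (S : Finset (Fin n)) (u : {i // i ∈ S} → α) (v : {i // i ∉ S} → α)
    {i : Fin n} (h : i ∈ S) : glue S u v i = u ⟨i, h⟩ := dif_pos h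

lemma glue_of_notMem (S : Finset (Fin n)) (u : {i // i ∈ S} → α) (v : {i // i ∉ S} → α)
    {i : Fin n} (h : i ∉ S) : glue S u v i = v ⟨i, h⟩ := dif_neg h

lemma sum_glue [Fintype α] (S : Finset (Fin n)) (φ : (Fin n → α) → ℂ) :
    ∑ f, φ f = ∑ u, ∑ v, φ (glue S u v) := by
  rw [← (Equiv.piEquivPiSubtypeProd (· ∈ S) fun _ => α).symm.sum_comp, Fintype.sum_prod_type]
  rfl

lemma ptr_smul_sum [Fintype α] {ι : Type*} (T : Finset (Fin n)) (t : Finset ι) (k : ℂ) (w : ι → ℂ)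
    (M : ι → Matrix (Fin n → α) (Fin n → α) ℂ) :
    ptr T (k • ∑ i ∈ t, w i • M i) = k • ∑ i ∈ t, w i • ptr T (M i) := by
  ext v v'
  simp only [ptr, Matrix.smul_apply, Matrix.sum_apply, smul_eq_mul, Finset.mul_sum]
  rw [Finset.sum_comm]

variable [AddCommGroup α]

lemma glue_add (S : Finset (Fin n)) (u u' : {i // i ∈ S} → α) (v v' : {i // i ∉ S} → α) :
    glue S (u + u') (v + v') = glue S u v + glue S u' v' := by
  funext i
  by_cases h : i ∈ S <;> simp [glue, h]

/-- A pair of label vectors vanishes on the qudits in `S`. -/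
def VanishOn (S : Finset (Fin n)) (a : (Fin n → α) × (Fin n → α)) : Prop :=
  ∀ i ∈ S, a.1 i = 0 ∧ a.2 i = 0

variable {b : α → α → ℂ}

lemma piPairing_eq_of_vanish (hb : IsBichar b) (S : Finset (Fin n)) {ν f g : Fin n → α}
    (hν : ∀ i ∈ S, ν i = 0) (hfg : ∀ i ∉ S, f i = g i) :
    piPairing b ν f = piPairing b ν g := by
  refine Finset.prod_congr rfl fun i _ => ?_
  by_cases h : i ∈ S
  · rw [hν i h, hb.zero_left, hb.zero_left]
  · rw [hfg i h]

variable [Fintype α] [DecidableEq α]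

lemma supportedIn_weyl_iff (hb : IsBichar b) (S : Finset (Fin n)) {c : ℂ} (hc : c ≠ 0)
    (a : (Fin n → α) × (Fin n → α)) :
    SupportedIn S (c • weyl (piPairing b) a.1 a.2) ↔ VanishOn Sᶜ a := by
  obtain ⟨μ, ν⟩ := a
  have hβ : IsBichar (piPairing b : (Fin n → α) → _ → ℂ) := hb.pi
  constructor
  · rintro ⟨M, hM⟩
    have hμ : ∀ i ∉ S, μ i = 0 := by
      have h := hM (0 + μ) 0
      simp only [Matrix.smul_apply, weyl, if_true, smul_eq_mul] at h
      split_ifs at h with h'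
      · intro i hi
        simpa using congrFun h' ⟨i, hi⟩
      · exact absurd h (mul_ne_zero hc (hβ.ne_zero _ _))
    intro i hi
    have hi' : i ∉ S := by simpa using hi
    refine ⟨hμ i hi', hb.nondeg _ fun y => ?_⟩
    rw [← piPairing_single hb ν i y, ← hβ.map_zero ν]
    have hS : ∀ g : Fin n → α, (fun j : {i // i ∉ S} => (g + μ) j) =
        fun j : {i // i ∉ S} => g j := fun g => by
      funext j
      simp [hμ j j.2]
    have h1 := hM (Pi.single i y + μ) (Pi.single i y)
    have h0 := hM (0 + μ) 0
    rw [if_pos (hS _)] at h1 h0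
    have he : ∀ j : {i // i ∈ S}, (Pi.single i y : Fin n → α) j = 0 := fun j =>
      Pi.single_eq_of_ne (fun h : (j : Fin n) = i => hi' (h ▸ j.2)) _
    simp only [Pi.add_apply, he] at h1
    simp only [Pi.add_apply, Pi.zero_apply] at h0
    rw [← h0] at h1
    simpa [weyl, hc] using h1
  · intro h
    have hμ : ∀ i ∉ S, μ i = 0 := fun i hi => (h i (by simpa using hi)).1
    have hν : ∀ i ∈ Sᶜ, ν i = 0 := fun i hi => (h i hi).2
    refine ⟨fun p q => (c • weyl (piPairing b) μ ν) (glue S p 0) (glue S q 0), fun f g => ?_⟩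
    simp only [Matrix.smul_apply, weyl, smul_eq_mul]
    have hp : piPairing b ν (glue S (fun i => g i) 0) = piPairing b ν g :=
      piPairing_eq_of_vanish hb Sᶜ hν fun i hi => by
        rw [glue_of_mem S _ _ (by simpa using hi)]
    rw [hp]
    split_ifs with h1 h2 h3 h2 h3
    · rfl
    · exfalso
      apply h3
      funext i
      by_cases hi : i ∈ S
      · simp [glue, hi, h1]
      · simp [glue, hi, hμ i hi]
    · exfalso
      apply h2
      funext i
      simp [h1, hμ i i.2]
    · exfalso
      apply h1
      funext i
      by_cases hi : i ∈ S
      · simpa [glue, hi] using congrFun h3 i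
      · simpa [hμ i hi] using congrFun h2 ⟨i, hi⟩
    · simp
    · simp

lemma ptr_weyl_eq_zero (hb : IsBichar b) (T : Finset (Fin n))
    (a : (Fin n → α) × (Fin n → α)) (ha : ¬ VanishOn T a) :
    ptr T (weyl (piPairing b) a.1 a.2) = 0 := by
  obtain ⟨μ, ν⟩ := a
  have hβ : IsBichar (piPairing b : (Fin n → α) → _ → ℂ) := hb.pi
  ext v w
  simp only [ptr, weyl, Matrix.zero_apply]
  by_cases hμ : ∀ i ∈ T, μ i = 0
  · obtain ⟨i, hi, hν⟩ : ∃ i ∈ T, ν i ≠ 0 := by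
      by_contra! h
      exact ha fun i hi => ⟨hμ i hi, h i hi⟩
    obtain ⟨y, hy⟩ : ∃ y, b (ν i) y ≠ 1 := by
      by_contra! h
      exact hν (hb.nondeg _ h)
    let u₀ : {i // i ∈ T} → α := fun j => (Pi.single i y : Fin n → α) j
    have hu₀ : glue T u₀ 0 = Pi.single i y := by
      funext j
      by_cases hj : j ∈ T
      · simp [glue, hj, u₀]
      · have : j ≠ i := fun h => hj (h ▸ hi)
        simp [glue, hj, this]
    refine sum_eq_zero_of_scale Finset.univ (fun u => u₀ + u) _ hy (by simp)
      (fun a _ c _ h => add_left_cancel h) fun u _ => ?_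
    have hv : glue T (u₀ + u) v = Pi.single i y + glue T u v := by
      rw [← hu₀, ← glue_add, zero_add]
    have hw : glue T (u₀ + u) w = Pi.single i y + glue T u w := by
      rw [← hu₀, ← glue_add, zero_add]
    rw [hv, hw, add_assoc, hβ.map_add, piPairing_single hb]
    simp only [add_right_inj, mul_ite, mul_zero]
  · push Not at hμ
    obtain ⟨i, hi, hne⟩ := hμ
    refine Finset.sum_eq_zero fun u _ => if_neg fun h => hne ?_
    simpa [glue, hi] using congrFun h i

lemma trace_ptr_mul_ptr (hb : IsBichar b) (T : Finset (Fin n))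
    (a : (Fin n → α) × (Fin n → α)) (ha : VanishOn T a)
    (F : Matrix (Fin n → α) (Fin n → α) ℂ) :
    (ptr T (weyl (piPairing b) a.1 a.2) * ptr T F).trace =
      (Fintype.card α : ℂ) ^ T.card * (weyl (piPairing b) a.1 a.2 * F).trace := by
  obtain ⟨μ, ν⟩ := a
  have key : ∀ u u' v w, weyl (piPairing b) μ ν (glue T u v) (glue T u' w) =
      if u = u' then weyl (piPairing b) μ ν (glue T 0 v) (glue T 0 w) else 0 := by
    intro u u' v w
    simp only [weyl]
    rw [piPairing_eq_of_vanish hb T (fun i hi => (ha i hi).2)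
      (f := glue T u' w) (g := glue T 0 w) fun i hi => by simp [glue, hi]]
    by_cases hu : u = u'
    · subst hu
      have : glue T u v = glue T u w + μ ↔ glue T 0 v = glue T 0 w + μ := by
        simp only [funext_iff]
        refine forall_congr' fun i => ?_
        by_cases hi : i ∈ T
        · have := (ha i hi).1
          simp_all [glue]
        · simp [glue, hi]
      simp [this]
    · rw [if_neg hu, if_neg]
      intro h
      refine hu (funext fun i => ?_)
      have := (ha i i.2).1
      have h' := congrFun h i
      simp_all [glue]
  have hptr : ∀ v w, ptr T (weyl (piPairing b) μ ν) v w =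
      (Fintype.card α : ℂ) ^ T.card * weyl (piPairing b) μ ν (glue T 0 v) (glue T 0 w) := by
    intro v w
    simp only [ptr]
    rw [Finset.sum_congr rfl fun u _ => key u u v w]
    simp
  have htr : (weyl (piPairing b) μ ν * F).trace = ∑ v, ∑ w,
      weyl (piPairing b) μ ν (glue T 0 v) (glue T 0 w) * ptr T F w v := by
    simp only [Matrix.trace, Matrix.diag, Matrix.mul_apply]
    rw [sum_glue T, Finset.sum_comm]
    refine Finset.sum_congr rfl fun v _ => ?_
    simp only [ptr, Finset.mul_sum]
    rw [Finset.sum_comm (s := Finset.univ (α := {i // i ∉ T} → α))]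
    refine Finset.sum_congr rfl fun u _ => ?_
    rw [sum_glue T, Finset.sum_eq_single u]
    · exact Finset.sum_congr rfl fun w _ => by rw [key, if_pos rfl]
    · intro u' _ hu
      exact Finset.sum_eq_zero fun w _ => by rw [key, if_neg hu.symm, zero_mul]
    · simp
  rw [htr, Finset.mul_sum]
  simp only [Matrix.trace, Matrix.diag, Matrix.mul_apply, hptr, Finset.mul_sum, mul_assoc]

instance (T : Finset (Fin n)) : DecidablePred (VanishOn (α := α) T) := fun a => by
  unfold VanishOn
  infer_instance

lemma card_vanishOn (T : Finset (Fin n)) :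
    (Finset.univ.filter (VanishOn (α := α) T)).card = (Fintype.card α ^ Tᶜ.card) ^ 2 := by
  let A : Finset (Fin n → α) := Fintype.piFinset fun i => if i ∈ T then {0} else Finset.univ
  have hA : Finset.univ.filter (VanishOn (α := α) T) = A ×ˢ A := by
    ext x
    simp only [VanishOn, Finset.mem_filter, Finset.mem_univ, true_and, Finset.mem_product, A,
      Fintype.mem_piFinset, ← forall_and]
    refine forall_congr' fun i => ?_
    by_cases hi : i ∈ T <;> simp [hi]
  have hc : A.card = Fintype.card α ^ Tᶜ.card := by
    rw [Fintype.card_piFinset, Finset.prod_congr rfl fun i _ => apply_ite Finset.card _ _ _,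
      Finset.prod_ite]
    simp [Finset.filter_not, Finset.compl_eq_univ_sdiff]
  rw [hA, Finset.card_product, hc, sq]

lemma sum_vanishOn_commPhase (hb : IsBichar b) (S : Finset (Fin n))
    (y : (Fin n → α) × (Fin n → α)) :
    ∑ x ∈ Finset.univ.filter (VanishOn Sᶜ), commPhase (piPairing b) x y =
      if VanishOn S y then ((Fintype.card α : ℂ) ^ S.card) ^ 2 else 0 := by
  have hβ : IsBichar (piPairing b : (Fin n → α) → _ → ℂ) := hb.pi
  split_ifs with h
  · have hone : ∀ x ∈ Finset.univ.filter (VanishOn (α := α) Sᶜ),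
        commPhase (piPairing b) x y = 1 := by
      intro x hx
      have hx' : VanishOn Sᶜ x := by simpa using hx
      have h1 : ∀ z w : Fin n → α, (∀ i ∈ Sᶜ, z i = 0) → (∀ i ∈ S, w i = 0) →
          piPairing b z w = 1 := by
        intro z w hz hw
        rw [piPairing_eq_of_vanish hb Sᶜ hz (g := 0) fun i hi => hw i (by simpa using hi),
          hβ.map_zero]
      rw [commPhase, h1 _ _ (fun i hi => (hx' i hi).2) fun i hi => (h i hi).1, hβ.symm,
        h1 _ _ (fun i hi => (hx' i hi).1) fun i hi => (h i hi).2, inv_one, mul_one]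
    rw [Finset.sum_congr rfl hone, Finset.sum_const, card_vanishOn, compl_compl]
    simp
  · obtain ⟨i, hi, hne⟩ : ∃ i ∈ S, ¬ (y.1 i = 0 ∧ y.2 i = 0) := by
      simpa only [VanishOn, not_forall, exists_prop] using h
    obtain ⟨x₀, hx₀, hc⟩ : ∃ x₀ : (Fin n → α) × (Fin n → α), VanishOn Sᶜ x₀ ∧
        commPhase (piPairing b) x₀ y ≠ 1 := by
      have hsingle : ∀ z : α, ∀ j ∈ Sᶜ, (Pi.single i z : Fin n → α) j = 0 := fun z j hj =>
        Pi.single_eq_of_ne (fun h : j = i => Finset.mem_compl.1 hj (h ▸ hi)) _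
      by_cases h1 : y.1 i = 0
      · obtain ⟨z, hz⟩ : ∃ z, b (y.2 i) z ≠ 1 := by
          by_contra! h'
          exact hne ⟨h1, hb.nondeg _ h'⟩
        refine ⟨(Pi.single i z, 0), fun j hj => ⟨hsingle z j hj, rfl⟩, ?_⟩
        simpa [commPhase, hβ.zero_left, piPairing_single hb] using hz
      · obtain ⟨z, hz⟩ : ∃ z, b (y.1 i) z ≠ 1 := by
          by_contra! h'
          exact h1 (hb.nondeg _ h')
        refine ⟨(0, Pi.single i z), fun j hj => ⟨rfl, hsingle z j hj⟩, ?_⟩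
        simpa [commPhase, hβ.map_zero, hβ.symm (Pi.single i z), piPairing_single hb] using hz
    refine sum_eq_zero_of_scale _ (x₀ + ·) _ hc (fun x hx => ?_)
      (fun _ _ _ _ h => add_left_cancel h) fun x _ => commPhase_add_left hβ _ _ _
    have hx' : VanishOn Sᶜ x := by simpa using hx
    rw [Finset.mem_filter]
    exact ⟨Finset.mem_univ _, fun j hj => by simp [hx₀ j hj, hx' j hj]⟩

variable {s : Finset (Matrix (Fin n → α) (Fin n → α) ℂ)}
  {a : Matrix (Fin n → α) (Fin n → α) ℂ → (Fin n → α) × (Fin n → α)}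
  {c : Matrix (Fin n → α) (Fin n → α) ℂ → ℂ}

lemma card_mul_card_centralizer (hb : IsBichar b) (ha : IsLabelling (piPairing b) s a c)
    (hmul : ∀ E ∈ s, ∀ F ∈ s, E * F ∈ s) (S : Finset (Fin n)) :
    (s.card : ℂ) * ((Finset.univ.filter fun x => VanishOn Sᶜ x ∧
        ∀ E ∈ s, commPhase (piPairing b) x (a E) = 1).card : ℂ) =
      ((Fintype.card α : ℂ) ^ S.card) ^ 2 * ((s.filter fun E => VanishOn S (a E)).card : ℂ) := by
  have h := Finset.sum_comm (s := Finset.univ.filter (VanishOn (α := α) Sᶜ)) (t := s)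
    (f := fun x E => commPhase (piPairing b) x (a E))
  simp only [sum_vanishOn_commPhase hb, ha.sum_commPhase hb.pi hmul] at h
  rw [← Finset.sum_filter, ← Finset.sum_filter, Finset.sum_const, Finset.sum_const,
    Finset.filter_filter, nsmul_eq_mul, nsmul_eq_mul] at h
  rw [mul_comm, h, mul_comm]

lemma trace_ptr_projector (hb : IsBichar b) (ha : IsLabelling (piPairing b) s a c)
    (hmul : ∀ E ∈ s, ∀ F ∈ s, E * F ∈ s) (lam : Matrix (Fin n → α) (Fin n → α) ℂ → ℂ)
    (hlam : ∀ E ∈ s, ∀ F ∈ s, lam (E * F) = lam E * lam F) (k : ℂ) (T : Finset (Fin n)) :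
    (ptr T (k • ∑ E ∈ s, (lam E)⁻¹ • E) * ptr T (k • ∑ E ∈ s, (lam E)⁻¹ • E)).trace =
      k ^ 2 * (Fintype.card α : ℂ) ^ T.card *
        ((s.filter fun E => VanishOn T (a E)).card : ℂ) *
          ∑ E ∈ s, (lam E)⁻¹ * E.trace := by
  have hterm : ∀ E ∈ s, ∑ F ∈ s, (lam E)⁻¹ * (lam F)⁻¹ * (ptr T E * ptr T F).trace =
      if VanishOn T (a E) then
        (Fintype.card α : ℂ) ^ T.card * ∑ F ∈ s, (lam F)⁻¹ * F.trace else 0 := by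
    intro E hE
    have hptr : ptr T E = c E • ptr T (weyl (piPairing b) (a E).1 (a E).2) := by
      conv_lhs => rw [(ha E hE).2]
      ext v w
      simp [ptr, Finset.mul_sum]
    split_ifs with h
    · rw [← sum_comp_of_injOn s (E * ·) (fun F => (lam F)⁻¹ * F.trace) (fun F hF => hmul E hE F hF)
        (ha.injOn_mul hb.pi hE), Finset.mul_sum]
      refine Finset.sum_congr rfl fun F hF => ?_
      have htr : (E * F).trace = c E * (weyl (piPairing b) (a E).1 (a E).2 * F).trace := by
        conv_lhs => rw [(ha E hE).2]
        simp
      rw [hlam E hE F hF, htr, hptr, Matrix.smul_mul, Matrix.trace_smul,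
        trace_ptr_mul_ptr hb T _ h, mul_inv, smul_eq_mul]
      ring
    · refine Finset.sum_eq_zero fun F _ => ?_
      rw [hptr, ptr_weyl_eq_zero hb T _ h]
      simp
  rw [ptr_smul_sum, Matrix.smul_mul, Matrix.mul_smul, Matrix.sum_mul, Matrix.trace_smul,
    Matrix.trace_smul, Matrix.trace_sum]
  have hexp : ∀ E ∈ s, ((lam E)⁻¹ • ptr T E * ∑ F ∈ s, (lam F)⁻¹ • ptr T F).trace =
      ∑ F ∈ s, (lam E)⁻¹ * (lam F)⁻¹ * (ptr T E * ptr T F).trace := by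
    intro E _
    simp [Matrix.trace_sum, Finset.mul_sum, mul_assoc, mul_left_comm (lam E)⁻¹]
  rw [Finset.sum_congr rfl fun E hE => (hexp E hE).trans (hterm E hE), ← Finset.sum_filter,
    Finset.sum_const, nsmul_eq_mul, smul_eq_mul, smul_eq_mul]
  ring

end Qudits
section Displacement

variable {D' : ℕ}

/-- The primitive root of unity `e^{2πi/D'}`. -/
def rootOfUnity (D' : ℕ) : ℂ := Complex.exp (2 * (Real.pi : ℂ) * Complex.I / D')

lemma exp_eq_rootOfUnity_pow (k : ℕ) :
    Complex.exp (2 * (Real.pi : ℂ) * Complex.I * (k : ℕ) / D') = rootOfUnity D' ^ k := by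
  rw [rootOfUnity, ← Complex.exp_nat_mul]
  congr 1
  ring

/-- The phase of an error operator with `γ = 0` relative to the Weyl operator. -/
def errPhase {l n : ℕ} (x : QIdx D' l n × QIdx D' l n) : ℂ :=
  Complex.exp ((Real.pi : ℂ) * Complex.I *
      ∑ i : Fin n, ∑ j : Fin l, ((x.1 i j : ℕ) : ℂ) * ((x.2 i j : ℕ) : ℂ)) *
    ∏ i : Fin n, ∏ j : Fin l,
      Complex.exp ((Real.pi : ℂ) * Complex.I * (x.1 i j : ℕ) * (x.2 i j : ℕ) / D')

lemma errPhase_ne_zero {l n : ℕ} (x : QIdx D' l n × QIdx D' l n) : errPhase x ≠ 0 :=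
  mul_ne_zero (Complex.exp_ne_zero _) <| Finset.prod_ne_zero_iff.2 fun _ _ =>
    Finset.prod_ne_zero_iff.2 fun _ _ => Complex.exp_ne_zero _

variable [NeZero D']

lemma Xmat_pow_apply (k : ℕ) (i j : Fin D') :
    (Xmat D' ^ k) i j = if (i : ℕ) = ((j : ℕ) + k) % D' then 1 else 0 := by
  induction k generalizing j with
  | zero => simp [Matrix.one_apply, Fin.ext_iff, Nat.mod_eq_of_lt j.2]
  | succ k ih =>
    rw [pow_succ, Matrix.mul_apply]
    have hlt : ((j : ℕ) + 1) % D' < D' := Nat.mod_lt _ (NeZero.pos D')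
    rw [Finset.sum_eq_single ⟨((j : ℕ) + 1) % D', hlt⟩]
    · rw [ih]
      simp [Xmat, Nat.mod_add_mod, add_assoc, add_comm 1 k]
    · intro h _ hh
      have : (h : ℕ) ≠ ((j : ℕ) + 1) % D' := fun h' => hh (Fin.ext h')
      simp [Xmat, this]
    · simp

lemma Dmat_apply (μ ν i j : Fin D') :
    Dmat D' μ ν i j = Complex.exp ((Real.pi : ℂ) * Complex.I * (μ : ℕ) * (ν : ℕ) / D') *
      if i = j + μ then finPairing (rootOfUnity D') ν j else 0 := by
  simp only [Dmat, Zmat, Matrix.diagonal_pow, Matrix.smul_apply, Matrix.mul_diagonal,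
    Xmat_pow_apply, Pi.pow_apply, exp_eq_rootOfUnity_pow, smul_eq_mul, Fin.ext_iff, Fin.val_add,
    finPairing]
  rw [← pow_mul, mul_comm (j : ℕ)]
  simp

/-- The pairing of multi-qudit configurations defining the displacement operators. -/
abbrev quditPairing (D' l n : ℕ) : QIdx D' l n → QIdx D' l n → ℂ :=
  piPairing (piPairing (finPairing (rootOfUnity D')))

lemma errPhase_zero {l n : ℕ} : errPhase (0 : QIdx D' l n × QIdx D' l n) = 1 := by
  simp [errPhase]

lemma DnMat_eq {l n : ℕ} (μ ν : QIdx D' l n) :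
    DnMat D' l n μ ν = (∏ i : Fin n, ∏ j : Fin l,
      Complex.exp ((Real.pi : ℂ) * Complex.I * (μ i j : ℕ) * (ν i j : ℕ) / D')) •
        weyl (quditPairing D' l n) μ ν := by
  ext f g
  simp only [DnMat, Dmat_apply, Finset.prod_mul_distrib, Finset.prod_ite_zero, Finset.mem_univ,
    true_implies, Matrix.smul_apply, smul_eq_mul, weyl, piPairing, funext_iff, Pi.add_apply]

lemma errOp_iff {l n : ℕ} (E : Matrix (QIdx D' l n) (QIdx D' l n) ℂ) :
    errOp D' l n E ↔ ∃ (γ : Fin D') (x : QIdx D' l n × QIdx D' l n),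
      E = (rootOfUnity D' ^ (γ : ℕ) * errPhase x) • weyl (quditPairing D' l n) x.1 x.2 := by
  simp only [errOp, DnMat_eq, smul_smul, exp_eq_rootOfUnity_pow, mul_assoc (_ ^ _), Prod.exists,
    errPhase]

lemma rootOfUnity_isPrimitiveRoot : IsPrimitiveRoot (rootOfUnity D') D' :=
  Complex.isPrimitiveRoot_exp D' (NeZero.ne D')

lemma isBichar_blockPairing {l : ℕ} (hD : 2 ≤ D') :
    IsBichar (piPairing (finPairing (rootOfUnity D')) :
      (Fin l → Fin D') → (Fin l → Fin D') → ℂ) :=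
  (isBichar_finPairing rootOfUnity_isPrimitiveRoot hD).pi

lemma smul_errPhase_injective {l n : ℕ} (hD : 2 ≤ D') :
    Function.Injective fun p : Fin D' × (QIdx D' l n × QIdx D' l n) =>
      (rootOfUnity D' ^ (p.1 : ℕ) * errPhase p.2) •
        weyl (quditPairing D' l n) p.2.1 p.2.2 := by
  rintro ⟨γ, x⟩ ⟨γ', x'⟩ h
  have hω := rootOfUnity_isPrimitiveRoot (D' := D')
  obtain ⟨hc, h1, h2⟩ := smul_weyl_inj (isBichar_blockPairing hD).pi
    (mul_ne_zero (pow_ne_zero _ (hω.ne_zero (NeZero.ne D'))) (errPhase_ne_zero x)) h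
  obtain rfl : x = x' := Prod.ext h1 h2
  have := hω.pow_inj γ.2 γ'.2 (mul_right_cancel₀ (errPhase_ne_zero x) hc)
  rw [Fin.ext this]

variable {l n : ℕ} {s : Finset (Matrix (QIdx D' l n) (QIdx D' l n) ℂ)}

lemma lam_center (hD : 2 ≤ D')
    (hcenter : ∀ γ : Fin D', rootOfUnity D' ^ (γ : ℕ) • 1 ∈ s)
    (lam : Matrix (QIdx D' l n) (QIdx D' l n) ℂ → ℂ)
    (hlam : ∀ E ∈ s, ∀ F ∈ s, lam (E * F) = lam E * lam F)
    (hlamz : lam (rootOfUnity D' • 1) = rootOfUnity D') (γ : Fin D') :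
    lam (rootOfUnity D' ^ (γ : ℕ) • 1) = rootOfUnity D' ^ (γ : ℕ) := by
  have hω := (rootOfUnity_isPrimitiveRoot (D' := D')).ne_zero (NeZero.ne D')
  have hmem : ∀ k < D', rootOfUnity D' ^ k • 1 ∈ s := fun k hk => hcenter ⟨k, hk⟩
  have h1 : rootOfUnity D' • 1 ∈ s := by simpa using hmem 1 hD
  obtain ⟨k, hk⟩ := γ
  induction k with
  | zero =>
    have h0 : (1 : Matrix (QIdx D' l n) (QIdx D' l n) ℂ) ∈ s := by
      simpa using hmem 0 (by omega)
    have h := hlam _ h1 _ h0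
    rw [mul_one, hlamz] at h
    simpa using mul_left_cancel₀ hω (h.symm.trans (mul_one _).symm)
  | succ k ih =>
    have h := hlam _ (hmem k (by omega)) _ h1
    rw [ih (by omega), hlamz, Matrix.smul_mul, one_mul, smul_smul] at h
    simpa [pow_succ] using h

lemma sum_lam_inv_mul_trace (hD : 2 ≤ D') (herr : ∀ E ∈ s, errOp D' l n E)
    (hcenter : ∀ γ : Fin D', rootOfUnity D' ^ (γ : ℕ) • 1 ∈ s)
    (lam : Matrix (QIdx D' l n) (QIdx D' l n) ℂ → ℂ)
    (hlam : ∀ E ∈ s, ∀ F ∈ s, lam (E * F) = lam E * lam F)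
    (hlamz : lam (rootOfUnity D' • 1) = rootOfUnity D') :
    ∑ E ∈ s, (lam E)⁻¹ * E.trace = D' * Fintype.card (QIdx D' l n) := by
  classical
  have hβ : IsBichar (quditPairing D' l n) := (isBichar_blockPairing hD).pi
  have hω := (rootOfUnity_isPrimitiveRoot (D' := D')).ne_zero (NeZero.ne D')
  let φ : Fin D' → Matrix (QIdx D' l n) (QIdx D' l n) ℂ := fun γ => rootOfUnity D' ^ (γ : ℕ) • 1
  have hφ : ∀ γ, φ γ = (rootOfUnity D' ^ (γ : ℕ) * errPhase (0 : QIdx D' l n × QIdx D' l n)) •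
      weyl (quditPairing D' l n) 0 0 := fun γ => by
    rw [weyl_zero hβ, errPhase_zero, mul_one]
  have hinj : Function.Injective φ := fun γ γ' h => by
    rw [hφ, hφ] at h
    exact congrArg Prod.fst (smul_errPhase_injective hD (a₁ := (γ, 0)) (a₂ := (γ', 0)) h)
  rw [← Finset.sum_subset (s₁ := Finset.univ.image φ)]
  · rw [Finset.sum_image fun _ _ _ _ h => hinj h]
    simp only [φ, lam_center hD hcenter lam hlam hlamz, Matrix.trace_smul, Matrix.trace_one,
      smul_eq_mul, inv_mul_cancel_left₀ (pow_ne_zero _ hω), Finset.sum_const, Finset.card_univ,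
      Fintype.card_fin, nsmul_eq_mul]
  · exact Finset.image_subset_iff.2 fun γ _ => hcenter γ
  · intro E hE hnot
    obtain ⟨γ, x, rfl⟩ := (errOp_iff E).1 (herr E hE)
    rw [Matrix.trace_smul, trace_weyl hβ, if_neg, smul_zero, mul_zero]
    rintro ⟨h1, h2⟩
    obtain rfl : x = 0 := Prod.ext h1 h2
    exact hnot (Finset.mem_image.2 ⟨γ, Finset.mem_univ _, hφ γ⟩)

lemma ncard_centralizer (hD : 2 ≤ D')
    {a : Matrix (QIdx D' l n) (QIdx D' l n) ℂ → QIdx D' l n × QIdx D' l n}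
    {c : Matrix (QIdx D' l n) (QIdx D' l n) ℂ → ℂ}
    (ha : IsLabelling (quditPairing D' l n) s a c) (S : Finset (Fin n))
    (t : Finset (QIdx D' l n × QIdx D' l n))
    (ht : ∀ x, x ∈ t ↔ VanishOn Sᶜ x ∧ ∀ E ∈ s, commPhase (quditPairing D' l n) x (a E) = 1) :
    Set.ncard {E | errOp D' l n E ∧ (∀ F ∈ s, E * F = F * E) ∧ SupportedIn S E} =
      D' * t.card := by
  have hβ : IsBichar (quditPairing D' l n) := (isBichar_blockPairing hD).pi
  have hω := (rootOfUnity_isPrimitiveRoot (D' := D')).ne_zero (NeZero.ne D')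
  have key : ∀ (γ : Fin D') x,
      ((∀ F ∈ s, ((rootOfUnity D' ^ (γ : ℕ) * errPhase x) •
          weyl (quditPairing D' l n) x.1 x.2) * F = F * ((rootOfUnity D' ^ (γ : ℕ) * errPhase x) •
          weyl (quditPairing D' l n) x.1 x.2)) ∧
        SupportedIn S ((rootOfUnity D' ^ (γ : ℕ) * errPhase x) •
          weyl (quditPairing D' l n) x.1 x.2)) ↔ x ∈ t := by
    intro γ x
    have hne : rootOfUnity D' ^ (γ : ℕ) * errPhase x ≠ 0 :=
      mul_ne_zero (pow_ne_zero _ hω) (errPhase_ne_zero x)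
    rw [ht, supportedIn_weyl_iff (isBichar_blockPairing hD) S hne, and_comm]
    refine and_congr_right fun _ => forall₂_congr fun F hF => ?_
    rw [← weyl_comm_iff hβ hne (ha F hF).1, ← (ha F hF).2]
  have hset : {E | errOp D' l n E ∧ (∀ F ∈ s, E * F = F * E) ∧ SupportedIn S E} =
      (fun p : Fin D' × (QIdx D' l n × QIdx D' l n) =>
        (rootOfUnity D' ^ (p.1 : ℕ) * errPhase p.2) •
          weyl (quditPairing D' l n) p.2.1 p.2.2) ''
        ((Finset.univ ×ˢ t : Finset (Fin D' × (QIdx D' l n × QIdx D' l n))) : Set _) := by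
    ext E
    constructor
    · rintro ⟨hE, h⟩
      obtain ⟨γ, x, rfl⟩ := (errOp_iff E).1 hE
      exact ⟨(γ, x), by simpa using (key γ x).1 h, rfl⟩
    · rintro ⟨⟨γ, x⟩, hx, rfl⟩
      exact ⟨(errOp_iff _).2 ⟨γ, x, rfl⟩, (key γ x).2 (by simpa using hx)⟩
  rw [hset, Set.ncard_image_of_injective _ (smul_errPhase_injective hD), Set.ncard_coe_finset,
    Finset.card_product, Finset.card_univ, Fintype.card_fin]

end Displacement

/-- For an `[[n,k]]_D` stabilizer code (`D = D'^l`, `D'` prime) with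
stabilizer `𝒮` (an abelian subgroup of the error group containing the center) and code
projector `P = |𝒮|⁻¹ Σ_{E∈𝒮} λ₀(E)⁻¹ E`, the Rains enumerators count stabilizer and
centralizer elements:
`A_S'(P) = |{E ∈ 𝒮 : supp E ⊆ S}| / (D^{|S|} D')` and
`B_S'(P) = |{E ∈ C(𝒮) : supp E ⊆ S}| / (D^{|S|} D')`. -/
theorem stmt_17 (D' l n K : ℕ) (hD' : Nat.Prime D') (hl : 1 ≤ l)
    (𝒮 : Finset (Matrix (QIdx D' l n) (QIdx D' l n) ℂ))
    (herr : ∀ E ∈ 𝒮, errOp D' l n E)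
    (hmul : ∀ E ∈ 𝒮, ∀ F ∈ 𝒮, E * F ∈ 𝒮)
    (habel : ∀ E ∈ 𝒮, ∀ F ∈ 𝒮, E * F = F * E)
    (hcenter : ∀ γ : Fin D',
      (Complex.exp (2 * (Real.pi : ℂ) * Complex.I * (γ : ℕ) / D') •
        (1 : Matrix (QIdx D' l n) (QIdx D' l n) ℂ)) ∈ 𝒮)
    (lam : Matrix (QIdx D' l n) (QIdx D' l n) ℂ → ℂ)
    (hchar : ∀ E ∈ 𝒮, ∀ F ∈ 𝒮, lam (E * F) = lam E * lam F)
    (hlamz : lam (Complex.exp (2 * (Real.pi : ℂ) * Complex.I / D') •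
        (1 : Matrix (QIdx D' l n) (QIdx D' l n) ℂ)) =
      Complex.exp (2 * (Real.pi : ℂ) * Complex.I / D'))
    (P : Matrix (QIdx D' l n) (QIdx D' l n) ℂ)
    (hP : P = ((𝒮.card : ℂ))⁻¹ • ∑ E ∈ 𝒮, (lam E)⁻¹ • E)
    (hK : 𝒮.card * K = D' * D' ^ (l * n)) :
    ∀ S : Finset (Fin n),
      (1 / (K : ℂ) ^ 2) * (ptr Sᶜ P * ptr Sᶜ P).trace =
          ((Set.ncard {E | E ∈ 𝒮 ∧ SupportedIn S E} : ℕ) : ℂ) /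
            (((D' : ℂ) ^ l) ^ S.card * (D' : ℂ)) ∧
      (1 / (K : ℂ)) * (ptr S P * ptr S P).trace =
          ((Set.ncard {E | errOp D' l n E ∧ (∀ F ∈ 𝒮, E * F = F * E) ∧
              SupportedIn S E} : ℕ) : ℂ) /
            (((D' : ℂ) ^ l) ^ S.card * (D' : ℂ)) := by
  have hD : 2 ≤ D' := hD'.two_le
  have : NeZero D' := ⟨hD'.ne_zero⟩
  have hb := isBichar_blockPairing (D' := D') (l := l) hD
  have hω := (rootOfUnity_isPrimitiveRoot (D' := D')).ne_zero (NeZero.ne D')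
  obtain ⟨a, c, ha⟩ : ∃ a c, IsLabelling (quditPairing D' l n) 𝒮 a c := by
    have h : ∀ E, ∃ p : (QIdx D' l n × QIdx D' l n) × ℂ, E ∈ 𝒮 →
        p.2 ≠ 0 ∧ E = p.2 • weyl (quditPairing D' l n) p.1.1 p.1.2 := fun E => by
      by_cases hE : E ∈ 𝒮
      · obtain ⟨γ, x, hx⟩ := (errOp_iff E).1 (herr E hE)
        exact ⟨(x, _), fun _ =>
          ⟨mul_ne_zero (pow_ne_zero _ hω) (errPhase_ne_zero x), hx⟩⟩
      · exact ⟨0, fun h => absurd h hE⟩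
    choose p hp using h
    exact ⟨fun E => (p E).1, fun E => (p E).2, hp⟩
  have hcenter' : ∀ γ : Fin D', rootOfUnity D' ^ (γ : ℕ) •
      (1 : Matrix (QIdx D' l n) (QIdx D' l n) ℂ) ∈ 𝒮 := fun γ => by
    rw [← exp_eq_rootOfUnity_pow]
    exact hcenter γ
  have hsum := sum_lam_inv_mul_trace hD herr hcenter' lam hchar hlamz
  have htr := trace_ptr_projector hb ha hmul lam hchar ((𝒮.card : ℂ))⁻¹
  rw [← hP, hsum] at htr
  have hq : (Fintype.card (Fin l → Fin D') : ℂ) = (D' : ℂ) ^ l := by simp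
  have hN : (Fintype.card (QIdx D' l n) : ℂ) = ((D' : ℂ) ^ l) ^ n := by simp
  have hD0 : (D' : ℂ) ≠ 0 := NeZero.ne _
  have hK' : (𝒮.card : ℂ) * K = D' * ((D' : ℂ) ^ l) ^ n := by
    rw [← pow_mul]
    exact_mod_cast hK
  have hK0 : (𝒮.card : ℂ) * K ≠ 0 := by
    rw [hK']
    exact mul_ne_zero hD0 (pow_ne_zero _ (pow_ne_zero _ hD0))
  have hcard0 := left_ne_zero_of_mul hK0
  have hKne := right_ne_zero_of_mul hK0
  rw [hN, ← hK', hq] at htr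
  intro S
  constructor
  · have hsupp : {E | E ∈ 𝒮 ∧ SupportedIn S E} =
        ((𝒮.filter fun E => VanishOn Sᶜ (a E) : Finset _) : Set _) := by
      ext E
      simp only [Set.mem_ofPred_eq, Finset.coe_filter]
      refine and_congr_right fun hE => ?_
      rw [← supportedIn_weyl_iff hb S (ha E hE).1, ← (ha E hE).2]
    rw [hsupp, Set.ncard_coe_finset, htr]
    have hsplit : ((D' : ℂ) ^ l) ^ S.card * ((D' : ℂ) ^ l) ^ Sᶜ.card = ((D' : ℂ) ^ l) ^ n := by
      rw [← pow_add, Finset.card_add_card_compl, Fintype.card_fin]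
    rw [← hsplit] at hK'
    field_simp
    linear_combination (-((𝒮.filter fun E => VanishOn Sᶜ (a E)).card : ℂ)) * hK'
  · rw [ncard_centralizer hD ha S (Finset.univ.filter fun x => VanishOn Sᶜ x ∧
        ∀ E ∈ 𝒮, commPhase (quditPairing D' l n) x (a E) = 1) fun x => by
      rw [Finset.mem_filter, and_iff_right (Finset.mem_univ _)], htr]
    have h := card_mul_card_centralizer hb ha hmul S
    rw [hq] at h
    push_cast
    field_simp
    linear_combination -h

end
end
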